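/- arXiv:q-alg/9705017 — 5 statements merged into one kernel-verified Lean document; each statement's English description precedes it below -/
import Mathlib

section
/- For every τ ∈ ℂ with Im τ > 0 and every t ∈ ℂ, the Jacobi theta function satisfies the product formula θ(t,τ) = 2 e^{πiτ/4} sin(πt) ∏_{j=1}^∞ (1 − q^j)(1 − q^j e^{2πit})(1 − q^j e^{−2πit}), where q = e^{2πiτ} (the infinite product converges since |q| < 1). -/
open Complex

/-- The first Jacobi theta function
`θ(t,τ) = −∑_{j∈ℤ} exp(πi(j+1/2)²τ + 2πi(j+1/2)(t+1/2))`. -/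
noncomputable def jacobiTheta1 (t τ : ℂ) : ℂ :=
  -∑' j : ℤ, Complex.exp (Real.pi * I * (j + 1/2) ^ 2 * τ +
    2 * Real.pi * I * (j + 1/2) * (t + 1/2))

open Filter Topology

/-- The finite product `(1-q)...(1-q^n)`. -/
noncomputable def qP (q : ℂ) (n : ℕ) : ℂ := ∏ i ∈ Finset.range n, (1 - q ^ (i + 1))

/-- Reciprocal of `qP`, extended by zero to negative integers. -/
noncomputable def qI (q : ℂ) (k : ℤ) : ℂ := if k < 0 then 0 else (qP q k.toNat)⁻¹

lemma one_sub_pow_ne (q : ℂ) (hq : ‖q‖ < 1) (i : ℕ) : 1 - q ^ (i + 1) ≠ 0 := by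
  intro h
  have h1 : q ^ (i + 1) = 1 := (sub_eq_zero.mp h).symm
  have h2 : ‖q‖ ^ (i + 1) = 1 := by rw [← norm_pow, h1, norm_one]
  have h3 : ‖q‖ ^ (i + 1) < 1 := pow_lt_one₀ (norm_nonneg _) hq (by omega)
  linarith

lemma qP_ne (q : ℂ) (hq : ‖q‖ < 1) (n : ℕ) : qP q n ≠ 0 :=
  Finset.prod_ne_zero_iff.mpr fun i _ => one_sub_pow_ne q hq i

lemma qI_rec (q : ℂ) (hq : ‖q‖ < 1) (k : ℤ) : qI q (k - 1) = (1 - q ^ k) * qI q k := by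
  rcases lt_trichotomy k 0 with h | h | h
  · simp [qI, h, show k - 1 < 0 by omega]
  · subst h; simp [qI]
  · obtain ⟨n, rfl⟩ : ∃ n : ℕ, k = n + 1 := ⟨(k - 1).toNat, by omega⟩
    have h1 : ¬ ((n : ℤ) + 1 < 0) := by omega
    have h2 : ((n : ℤ) + 1).toNat = n + 1 := by omega
    have h3 : (q : ℂ) ^ ((n : ℤ) + 1) = q ^ (n + 1) := by exact_mod_cast zpow_natCast q (n + 1)
    have := one_sub_pow_ne q hq n
    have := qP_ne q hq n
    have h4 : qP q (n + 1) = qP q n * (1 - q ^ (n + 1)) := by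
      simp [qP, Finset.prod_range_succ]
    simp only [qI, add_sub_cancel_right, h1, h2, h3, h4, if_false, Int.toNat_natCast,
      show ¬ ((n : ℤ) < 0) by omega]
    field_simp

lemma qP_succ (q : ℂ) (n : ℕ) : qP q (n + 1) = qP q n * (1 - q ^ (n + 1)) := by
  simp [qP, Finset.prod_range_succ]

/-- Finite Jacobi triple product. -/
lemma finite_triple (q w : ℂ) (hq0 : q ≠ 0) (hw : w ≠ 0) (hq : ‖q‖ < 1) (S : ℤ → ℂ)
    (hS0 : S 0 = 1) (hS : ∀ j, S (j + 1) = -(q ^ j * w * S j)) (a b : ℕ) :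
    HasSum (fun j : ℤ => S j * (qP q (a + b) * qI q (a - j) * qI q (b + j)))
      ((∏ i ∈ Finset.range a, (1 - q ^ i * w)) *
        ∏ i ∈ Finset.range b, (1 - q ^ (i + 1) * w⁻¹)) := by
  induction a with
  | zero =>
    induction b with
    | zero =>
      have := hasSum_single (f := fun j : ℤ => S j * (qP q (0 + 0) * qI q ((0 : ℕ) - j) * qI q ((0 : ℕ) + j))) 0 ?_
      · simpa [hS0, qP, qI] using this
      · intro j hj
        rcases lt_or_gt_of_ne hj with h | h
        · simp [qI, h]
        · simp [qI, h]
    | succ b ih =>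
      rw [Finset.prod_range_succ, ← mul_assoc]
      have h2 := ((Equiv.addRight (1 : ℤ)).hasSum_iff.mpr ih).mul_left (q ^ (b + 1) * w⁻¹)
      have h3 := ih.sub h2
      convert! h3 using 1
      · funext j
        simp only [Function.comp, Equiv.coe_addRight, hS, Nat.cast_zero, zero_add]
        have e1 := qI_rec q hq (0 - j)
        have e2 := qI_rec q hq (b + 1 + j)
        rw [show (0 : ℤ) - (j + 1) = 0 - j - 1 by ring, e1,
          show (((b + 1 : ℕ) : ℤ)) + j = b + 1 + j by push_cast; ring,
          show (b : ℤ) + (j + 1) = b + 1 + j by ring,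
          show (b : ℤ) + j = b + 1 + j - 1 by ring, e2, qP_succ]
        rw [zpow_sub₀ hq0, zpow_add₀ hq0, zpow_add₀ hq0, zpow_natCast]
        have := zpow_ne_zero j hq0
        simp only [zpow_zero, zpow_one]
        field_simp
        ring
      · ring
  | succ a ih =>
    rw [Finset.prod_range_succ]
    have h2 := ((Equiv.subRight (1 : ℤ)).hasSum_iff.mpr ih).mul_left (q ^ a * w)
    have h3 := ih.sub h2
    convert! h3 using 1
    · funext j
      simp only [Function.comp, Equiv.subRight_apply]
      have e0 := hS (j - 1)
      rw [sub_add_cancel] at e0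
      have e1 := qI_rec q hq (a + 1 - j)
      have e2 := qI_rec q hq (b + j)
      rw [e0, show (a : ℤ) - (j - 1) = a + 1 - j by ring,
          show (((a + 1 : ℕ) : ℤ)) - j = a + 1 - j by push_cast; ring,
          show (b : ℤ) + (j - 1) = b + j - 1 by ring,
          show (a : ℤ) - j = a + 1 - j - 1 by ring, e1, e2,
          show a + 1 + b = a + b + 1 by ring, qP_succ]
      rw [zpow_sub₀ hq0, zpow_sub₀ hq0, zpow_add₀ hq0, zpow_add₀ hq0, zpow_natCast, zpow_natCast]
      have := zpow_ne_zero j hq0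
      simp only [zpow_one]
      field_simp
      ring
    · ring

lemma mult_aux (q c : ℂ) (hq : ‖q‖ < 1) : Multipliable fun j : ℕ => (1 - q ^ (j + 1) * c) := by
  have : Summable fun j : ℕ => ‖-(q ^ (j + 1) * c)‖ := by
    have := ((summable_geometric_of_lt_one (norm_nonneg q) hq).mul_left ‖q‖).mul_right ‖c‖
    refine this.congr fun j => ?_
    simp [pow_succ']
  simpa [sub_eq_add_neg] using multipliable_one_add_of_summable this

lemma qP_tendsto (q : ℂ) (hq : ‖q‖ < 1) : ∃ L : ℂ, L ≠ 0 ∧ Tendsto (qP q) atTop (𝓝 L) := by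
  refine ⟨∏' j : ℕ, (1 - q ^ (j + 1)), ?_, ?_⟩
  · have h := tprod_one_add_ne_zero_of_summable (f := fun j : ℕ => -q ^ (j + 1)) ?_ ?_
    · simpa [sub_eq_add_neg] using h
    · intro j
      simpa [sub_eq_add_neg] using one_sub_pow_ne q hq j
    · refine ((summable_geometric_of_lt_one (norm_nonneg q) hq).mul_left ‖q‖).congr fun j => ?_
      simp [pow_succ']
  · have := (mult_aux q 1 hq).hasProd.tendsto_prod_nat
    simp only [mul_one] at this
    exact this

lemma qI_tendsto (q : ℂ) (L : ℂ) (hL : L ≠ 0) (h : Tendsto (qP q) atTop (𝓝 L))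
    (f : ℕ → ℤ) (hf : Tendsto f atTop atTop) :
    Tendsto (fun n => qI q (f n)) atTop (𝓝 L⁻¹) := by
  have h1 : Tendsto (fun k : ℤ => k.toNat) atTop atTop :=
    tendsto_atTop.mpr fun b => by
      filter_upwards [eventually_ge_atTop (b : ℤ)] with k hk
      omega
  have h2 := ((h.comp h1).comp hf).inv₀ hL
  refine h2.congr' ?_
  filter_upwards [hf.eventually_ge_atTop 0] with n hn
  simp [qI, not_lt.mpr hn]

lemma bdd_of_tendsto (u : ℕ → ℂ) (L : ℂ) (h : Tendsto u atTop (𝓝 L)) :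
    ∃ C : ℝ, 0 ≤ C ∧ ∀ n, ‖u n‖ ≤ C := by
  obtain ⟨C, hC⟩ := h.norm.bddAbove_range
  exact ⟨C, (norm_nonneg _).trans (hC ⟨0, rfl⟩), fun n => hC ⟨n, rfl⟩⟩

lemma triple (q w : ℂ) (hq0 : q ≠ 0) (hw : w ≠ 0) (hq : ‖q‖ < 1) (S : ℤ → ℂ)
    (hS0 : S 0 = 1) (hS : ∀ j, S (j + 1) = -(q ^ j * w * S j)) (hs : Summable fun j => ‖S j‖) :
    Tendsto (fun n : ℕ => qP q n * ((∏ i ∈ Finset.range n, (1 - q ^ i * w)) *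
        ∏ i ∈ Finset.range (n + 1), (1 - q ^ (i + 1) * w⁻¹))) atTop (𝓝 (∑' j, S j)) := by
  obtain ⟨L, hL, hLt⟩ := qP_tendsto q hq
  obtain ⟨A, hA0, hA⟩ := bdd_of_tendsto _ _ hLt
  obtain ⟨B, hB0, hB'⟩ := bdd_of_tendsto _ _ (hLt.inv₀ hL)
  have hB : ∀ k, ‖qI q k‖ ≤ B := by
    intro k
    unfold qI
    split_ifs
    · simpa using hB0
    · exact hB' _
  have key : ∀ n : ℕ, qP q n * ((∏ i ∈ Finset.range n, (1 - q ^ i * w)) *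
        ∏ i ∈ Finset.range (n + 1), (1 - q ^ (i + 1) * w⁻¹)) =
      ∑' j : ℤ, qP q n * (S j * (qP q (n + (n + 1)) * qI q (n - j) * qI q ((n + 1 : ℕ) + j))) :=
    fun n => ((finite_triple q w hq0 hw hq S hS0 hS n (n + 1)).mul_left _).tsum_eq.symm
  simp_rw [key]
  refine tendsto_tsum_of_dominated_convergence (bound := fun j => A * (‖S j‖ * (A * B * B)))
    ((hs.mul_right _).mul_left _) ?_ ?_
  · intro j
    have t1 : Tendsto (fun n : ℕ => n + (n + 1)) atTop atTop :=
      tendsto_atTop_mono (fun n => by simp only [id]; omega) tendsto_id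
    have t2 : Tendsto (fun n : ℕ => (n : ℤ) - j) atTop atTop :=
      tendsto_atTop_add_const_right _ (-j) tendsto_natCast_atTop_atTop
    have t3 : Tendsto (fun n : ℕ => ((n + 1 : ℕ) : ℤ) + j) atTop atTop :=
      tendsto_atTop_add_const_right _ j
        (tendsto_natCast_atTop_atTop.comp (tendsto_add_atTop_nat 1))
    have := hLt.mul ((((hLt.comp t1).mul (qI_tendsto q L hL hLt _ t2)).mul
      (qI_tendsto q L hL hLt _ t3)).const_mul (S j))
    have e : L * (S j * (L * L⁻¹ * L⁻¹)) = S j := by field_simp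
    rw [e] at this
    exact this
  · refine Eventually.of_forall fun n j => ?_
    simp only [norm_mul]
    gcongr <;> first | exact hA _ | exact hB _

/-- **Product formula for the Jacobi theta function.**
For Im τ > 0 and t ∈ ℂ,
`θ(t,τ) = 2 e^{πiτ/4} sin(πt) ∏_{j=1}^∞ (1 − q^j)(1 − q^j e^{2πit})(1 − q^j e^{−2πit})`
with `q = e^{2πiτ}`. -/
theorem jacobiTheta1_product_formula (τ : ℂ) (hτ : 0 < τ.im) (t : ℂ) :
    jacobiTheta1 t τ =
      2 * Complex.exp (Real.pi * I * τ / 4) * Complex.sin (Real.pi * t) *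
        ∏' j : ℕ,
          ((1 - Complex.exp (2 * Real.pi * I * τ) ^ (j + 1)) *
           (1 - Complex.exp (2 * Real.pi * I * τ) ^ (j + 1) *
                Complex.exp (2 * Real.pi * I * t)) *
           (1 - Complex.exp (2 * Real.pi * I * τ) ^ (j + 1) *
                Complex.exp (-(2 * Real.pi * I * t)))) := by
  set q := Complex.exp (2 * Real.pi * I * τ) with hqd
  set z := Complex.exp (2 * Real.pi * I * t) with hzd
  have hz : z ≠ 0 := Complex.exp_ne_zero _
  have hq0 : q ≠ 0 := Complex.exp_ne_zero _
  have hzi : Complex.exp (-(2 * Real.pi * I * t)) = z⁻¹ := Complex.exp_neg _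
  have hq : ‖q‖ < 1 := by
    rw [hqd, Complex.norm_exp, Real.exp_lt_one_iff]
    have : (2 * Real.pi * I * τ : ℂ).re = -(2 * Real.pi * τ.im) := by simp
    rw [this]
    have := Real.pi_pos
    have : 0 < 2 * Real.pi * τ.im := by positivity
    linarith
  rw [hzi]
  set S : ℤ → ℂ := fun j => jacobiTheta₂_term j (t + 1 / 2 + τ / 2) τ with hSd
  have hS0 : S 0 = 1 := by simp [hSd, jacobiTheta₂_term]
  have hS : ∀ j, S (j + 1) = -(q ^ j * (q * z) * S j) := by
    intro j
    have : -(q ^ j * (q * z) * S j) = q ^ j * (q * z) * S j * Complex.exp (Real.pi * I) := by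
      rw [Complex.exp_pi_mul_I]; ring
    rw [this, hqd, hzd, ← Complex.exp_int_mul]
    simp only [hSd, jacobiTheta₂_term, ← Complex.exp_add]
    congr 1
    push_cast
    ring
  have hs : Summable fun j => ‖S j‖ :=
    ((summable_jacobiTheta₂_term_iff _ _).mpr hτ).norm
  have h1 := triple q (q * z) hq0 (mul_ne_zero hq0 hz) hq S hS0 hS hs
  have hm := ((mult_aux q 1 hq).mul (mult_aux q z hq)).mul (mult_aux q z⁻¹ hq)
  simp only [mul_one] at hm
  have h2 := hm.hasProd.tendsto_prod_nat.const_mul (1 - z⁻¹)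
  have h3 : ∑' j, S j = (1 - z⁻¹) * ∏' j : ℕ,
      ((1 - q ^ (j + 1)) * (1 - q ^ (j + 1) * z) * (1 - q ^ (j + 1) * z⁻¹)) := by
    refine tendsto_nhds_unique h1 (h2.congr fun n => ?_)
    rw [Finset.prod_range_succ', Finset.prod_mul_distrib, Finset.prod_mul_distrib, qP]
    have e1 : ∀ i : ℕ, q ^ i * (q * z) = q ^ (i + 1) * z := fun i => by ring
    have e2 : ∀ i : ℕ, q ^ (i + 1) * (q * z)⁻¹ = q ^ i * z⁻¹ := fun i => by
      field_simp
      ring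
    simp only [e1, e2]
    simp only [pow_zero, one_mul]
    ring
  have h4 : jacobiTheta1 t τ =
      -(Complex.exp (Real.pi * I * τ / 4 + Real.pi * I * t + Real.pi / 2 * I) * ∑' j, S j) := by
    rw [jacobiTheta1, ← tsum_mul_left]
    congr 1
    refine tsum_congr fun j => ?_
    simp only [hSd, jacobiTheta₂_term, ← Complex.exp_add]
    congr 1
    ring
  have h5 : Complex.exp (Real.pi * I * t) * (1 - z⁻¹) = 2 * I * Complex.sin (Real.pi * t) := by
    rw [mul_sub, ← hzi, ← Complex.exp_add, Complex.sin]
    rw [show (Real.pi * I * t + -(2 * Real.pi * I * t) : ℂ) = -(Real.pi * t) * I by ring,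
      show (Real.pi * I * t : ℂ) = Real.pi * t * I by ring]
    linear_combination (Complex.exp (Real.pi * t * I) - Complex.exp (-(Real.pi * t) * I)) * Complex.I_sq
  rw [h4, h3, Complex.exp_add, Complex.exp_add, Complex.exp_pi_div_two_mul_I]
  generalize (∏' j : ℕ,
      ((1 - q ^ (j + 1)) * (1 - q ^ (j + 1) * z) * (1 - q ^ (j + 1) * z⁻¹))) = P
  linear_combination (-Complex.exp (Real.pi * I * τ / 4) * I * P) * h5 -
    2 * Complex.exp (Real.pi * I * τ / 4) * Complex.sin (Real.pi * t) * P * Complex.I_sq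
end

section
/- For every τ ∈ ℂ with Im τ > 0, the zero set of the entire function t ↦ θ(t,τ) is exactly the lattice ℤ + τℤ, and every zero is simple, i.e. the derivative ∂θ/∂t (t,τ) is nonzero at every point t ∈ ℤ + τℤ. -/
open Complex

open Filter Topology

/-- The Euler type product `∏ (1 - p^(k+1) v)`. -/
noncomputable def eulerPr (p v : ℂ) : ℂ := ∏' k : ℕ, (1 + -(p ^ (k + 1) * v))

lemma eulerPr_summable {p : ℂ} (hp : ‖p‖ < 1) (v : ℂ) :
    Summable (fun k : ℕ => ‖-(p ^ (k + 1) * v)‖) := by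
  simp only [norm_neg, norm_mul, norm_pow]
  exact ((summable_nat_add_iff 1).mpr
    (summable_geometric_of_lt_one (norm_nonneg _) hp)).mul_right _

lemma eulerPr_tendsto {p : ℂ} (hp : ‖p‖ < 1) (v : ℂ) :
    Tendsto (fun n : ℕ => ∏ k ∈ Finset.range n, (1 - p ^ (k + 1) * v)) atTop
      (𝓝 (eulerPr p v)) := by
  have := (multipliable_one_add_of_summable (eulerPr_summable hp v)).hasProd.tendsto_prod_nat
  simpa only [eulerPr, sub_eq_add_neg] using this

lemma eulerPr_eq_zero_iff {p : ℂ} (hp : ‖p‖ < 1) (v : ℂ) :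
    eulerPr p v = 0 ↔ ∃ k : ℕ, p ^ (k + 1) * v = 1 := by
  constructor
  · intro h
    by_contra! hc
    refine tprod_one_add_ne_zero_of_summable (f := fun k : ℕ => -(p ^ (k + 1) * v)) ?_
      (eulerPr_summable hp v) h
    intro i hi
    exact hc i (by linear_combination -hi)
  · rintro ⟨k, hk⟩
    refine tendsto_nhds_unique (eulerPr_tendsto hp v) ?_
    refine tendsto_const_nhds.congr' ?_
    filter_upwards [eventually_gt_atTop k] with n hn
    exact (Finset.prod_eq_zero (Finset.mem_range.mpr hn) (by rw [hk, sub_self])).symm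

lemma eulerPr_step {p : ℂ} (hp : ‖p‖ < 1) (v : ℂ) :
    eulerPr p v = (1 - p * v) * eulerPr p (p * v) := by
  refine tendsto_nhds_unique ((tendsto_add_atTop_iff_nat 1).mpr (eulerPr_tendsto hp v)) ?_
  refine ((eulerPr_tendsto hp (p * v)).const_mul (1 - p * v)).congr fun n => ?_
  rw [Finset.prod_range_succ', mul_comm]
  simp only [zero_add, pow_one]
  congr 1
  refine Finset.prod_congr rfl fun k _ => by ring

lemma eulerPr_differentiableOn {p : ℂ} (hp : ‖p‖ < 1) :
    DifferentiableOn ℂ (eulerPr p) (Metric.ball (0 : ℂ) 2) := by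
  have h : HasProdLocallyUniformlyOn (fun (k : ℕ) (v : ℂ) => 1 + -(p ^ (k + 1) * v))
      (eulerPr p) (Metric.ball (0 : ℂ) 2) := by
    refine Summable.hasProdLocallyUniformlyOn_nat_one_add (u := fun k => ‖p‖ ^ (k + 1) * 2)
      Metric.isOpen_ball ?_ (.of_forall fun n x hx => ?_) (fun n => by fun_prop)
    · exact ((summable_nat_add_iff 1).mpr
        (summable_geometric_of_lt_one (norm_nonneg _) hp)).mul_right _
    · rw [norm_neg, norm_mul, norm_pow]
      have : ‖x‖ < 2 := by simpa using hx
      gcongr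
  refine h.differentiableOn (.of_forall fun F ↦ ?_) Metric.isOpen_ball
  have : DifferentiableOn ℂ (fun v : ℂ => ∏ k ∈ F, (1 + -(p ^ (k + 1) * v)))
      (Metric.ball (0 : ℂ) 2) := DifferentiableOn.fun_finsetProd (fun _ _ ↦ by fun_prop)
  exact this

/-- Inverse of the finite Euler product, extended by zero to negative integers. -/
noncomputable def invQ (p : ℂ) (m : ℤ) : ℂ :=
  if 0 ≤ m then (∏ k ∈ Finset.range m.toNat, (1 - p ^ (k + 1) * 1))⁻¹ else 0

lemma one_sub_pow_ne_s2 {p : ℂ} (hp : ‖p‖ < 1) (k : ℕ) : 1 - p ^ (k + 1) ≠ 0 := by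
  intro h
  have h1 : ‖p ^ (k + 1)‖ = 1 := by
    rw [← sub_eq_zero.mp h, norm_one]
  rw [norm_pow] at h1
  exact (pow_lt_one₀ (norm_nonneg _) hp (by omega)).ne h1

lemma eulerPr_one_ne {p : ℂ} (hp : ‖p‖ < 1) : eulerPr p 1 ≠ 0 := by
  rw [Ne, eulerPr_eq_zero_iff hp]
  rintro ⟨k, hk⟩
  exact one_sub_pow_ne_s2 hp k (by linear_combination -hk)

lemma invQ_zero (p : ℂ) : invQ p 0 = 1 := by simp [invQ]

lemma invQ_neg (p : ℂ) {m : ℤ} (hm : m < 0) : invQ p m = 0 := by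
  simp [invQ, hm]

lemma invQ_step {p : ℂ} (hp : ‖p‖ < 1) (m : ℤ) :
    invQ p (m - 1) = (1 - p ^ m) * invQ p m := by
  rcases lt_trichotomy m 0 with h | h | h
  · rw [invQ_neg p h, invQ_neg p (by omega), mul_zero]
  · subst h; rw [invQ_neg p (by omega)]; simp
  · obtain ⟨n, rfl⟩ : ∃ n : ℕ, m = n + 1 := ⟨(m - 1).toNat, by omega⟩
    have h1 : ((n : ℤ) + 1).toNat = n + 1 := by omega
    have h2 : (p ^ ((n : ℤ) + 1) : ℂ) = p ^ (n + 1) := by exact_mod_cast zpow_natCast p (n + 1)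
    have h3 := one_sub_pow_ne_s2 hp n
    rw [invQ, invQ, if_pos (by omega), if_pos (by omega), h1, h2]
    simp only [add_sub_cancel_right, Int.toNat_natCast]
    rw [Finset.prod_range_succ, mul_inv, mul_one (p ^ (n + 1))]
    field_simp

lemma invQ_tendsto_nat {p : ℂ} (hp : ‖p‖ < 1) :
    Tendsto (fun n : ℕ => invQ p n) atTop (𝓝 (eulerPr p 1)⁻¹) := by
  refine ((eulerPr_tendsto hp 1).inv₀ (eulerPr_one_ne hp)).congr fun n => ?_
  simp [invQ]

lemma invQ_tendsto {p : ℂ} (hp : ‖p‖ < 1) :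
    Tendsto (fun n : ℤ => invQ p n) atTop (𝓝 (eulerPr p 1)⁻¹) := by
  have h : Tendsto (fun n : ℤ => n.toNat) atTop atTop := by
    rw [tendsto_atTop]
    intro b
    filter_upwards [eventually_ge_atTop (b : ℤ)] with n hn
    omega
  refine ((invQ_tendsto_nat hp).comp h).congr' ?_
  filter_upwards [eventually_ge_atTop (0 : ℤ)] with n hn
  simp [hn]

lemma invQ_bounded {p : ℂ} (hp : ‖p‖ < 1) : ∃ M : ℝ, 0 ≤ M ∧ ∀ m, ‖invQ p m‖ ≤ M := by
  obtain ⟨M, hM⟩ := (Metric.isBounded_range_of_tendsto _ (invQ_tendsto_nat hp)).exists_norm_le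
  have h0 : 0 ≤ M := (norm_nonneg _).trans (hM (invQ p (0 : ℕ)) ⟨0, rfl⟩)
  refine ⟨M, h0, fun m => ?_⟩
  rcases lt_or_ge m 0 with h | h
  · rw [invQ_neg p h]; simpa using h0
  · lift m to ℕ using h
    exact hM _ ⟨m, rfl⟩

/-- Jacobi triple product, in abstract form. -/
lemma triple_product {p u : ℂ} (hp : ‖p‖ < 1) (hp0 : p ≠ 0) (hu : u ≠ 0) (e : ℤ → ℂ)
    (he0 : e 0 = 1) (he : ∀ j, e (j + 1) = -u * p ^ (j + 1) * e j)
    (hs : Summable (fun j => ‖e j‖)) :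
    ∑' j, e j = eulerPr p 1 * (eulerPr p u * eulerPr p (p * u)⁻¹) := by
  obtain ⟨M, hM0, hM⟩ := invQ_bounded hp
  obtain ⟨s, hsdef⟩ : ∃ s : ℕ → ℤ → ℂ,
      s = fun (n : ℕ) (j : ℤ) => e j * (invQ p (n - j) * invQ p (n + j)) := ⟨_, rfl⟩
  have hbd : ∀ n j, ‖s n j‖ ≤ ‖e j‖ * (M * M) := fun n j => by
    simp only [hsdef, norm_mul]
    gcongr <;> exact hM _
  have hsum : ∀ n, Summable (s n) := fun n =>
    Summable.of_norm_bounded (hs.mul_right (M * M)) (hbd n)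
  -- limit
  have hlim : Tendsto (fun n => ∑' j, s n j) atTop
      (𝓝 (∑' j, e j * ((eulerPr p 1)⁻¹ * (eulerPr p 1)⁻¹))) := by
    rw [hsdef] at hbd ⊢
    refine tendsto_tsum_of_dominated_convergence (hs.mul_right (M * M)) (fun j => ?_)
      (.of_forall hbd)
    refine Tendsto.const_mul _ (Tendsto.mul ?_ ?_)
    · refine (invQ_tendsto hp).comp ?_
      exact tendsto_atTop_add_const_right _ (-j) tendsto_natCast_atTop_atTop
    · refine (invQ_tendsto hp).comp ?_
      exact tendsto_atTop_add_const_right _ j tendsto_natCast_atTop_atTop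
  -- recursion
  have hterm : ∀ (n : ℕ) (j : ℤ), (1 - p ^ (2 * n + 1)) * (1 - p ^ (2 * n + 2)) * s (n + 1) j =
      (1 + p ^ (2 * n + 1)) * s n j - p ^ (n + 1) * u * s n (j - 1) -
        p ^ n * u⁻¹ * s n (j + 1) := by
    intro n j
    have e1 : e (j + 1) = -u * (p ^ j * p) * e j := by rw [he, zpow_add_one₀ hp0]
    have e2 : e j = -u * p ^ j * e (j - 1) := by
      have := he (j - 1); rwa [sub_add_cancel] at this
    have hpj : p ^ j ≠ 0 := zpow_ne_zero _ hp0
    have e3 : e (j - 1) = -u⁻¹ * (p ^ j)⁻¹ * e j := by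
      rw [e2]; field_simp
    have hx : p ^ ((n : ℤ) + 1 - j) = p ^ n * p * (p ^ j)⁻¹ := by
      rw [zpow_sub₀ hp0, zpow_add_one₀ hp0, zpow_natCast, div_eq_mul_inv]
    have hy : p ^ ((n : ℤ) + 1 + j) = p ^ n * p * p ^ j := by
      rw [zpow_add₀ hp0, zpow_add_one₀ hp0, zpow_natCast]
    have hx' : p ^ ((n : ℤ) - j) = p ^ n * (p ^ j)⁻¹ := by
      rw [zpow_sub₀ hp0, zpow_natCast, div_eq_mul_inv]
    have hy' : p ^ ((n : ℤ) + j) = p ^ n * p ^ j := by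
      rw [zpow_add₀ hp0, zpow_natCast]
    have a1 := invQ_step hp ((n : ℤ) + 1 - j)
    have b1 := invQ_step hp ((n : ℤ) + 1 + j)
    have a2 := invQ_step hp ((n : ℤ) - j)
    have b2 := invQ_step hp ((n : ℤ) + j)
    rw [show (n : ℤ) + 1 - j - 1 = n - j by ring, hx] at a1
    rw [show (n : ℤ) + 1 + j - 1 = n + j by ring, hy] at b1
    rw [hx', a1] at a2
    rw [hy', b1] at b2
    simp only [hsdef]
    push_cast
    rw [show (n : ℤ) - (j - 1) = n + 1 - j by ring, show (n : ℤ) + (j - 1) = n + j - 1 by ring,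
      show (n : ℤ) - (j + 1) = n - j - 1 by ring, show (n : ℤ) + (j + 1) = n + 1 + j by ring,
      a2, b2, a1, b1, e1, e3]
    generalize invQ p ((n : ℤ) + 1 - j) = a
    generalize invQ p ((n : ℤ) + 1 + j) = b
    rw [show p ^ (2 * n + 1) = (p ^ n) ^ 2 * p by ring,
      show p ^ (2 * n + 2) = (p ^ n) ^ 2 * p ^ 2 by ring, pow_succ p n]
    generalize p ^ n = P
    generalize p ^ j = J at *
    field_simp
    ring
  have hrec : ∀ n : ℕ, (1 - p ^ (2 * n + 1)) * (1 - p ^ (2 * n + 2)) * ∑' j, s (n + 1) j =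
      (1 - p ^ (n + 1) * u) * (1 - p ^ n * u⁻¹) * ∑' j, s n j := by
    intro n
    have h1 : ∑' j, s n (j - 1) = ∑' j, s n j := (Equiv.subRight (1 : ℤ)).tsum_eq (s n)
    have h2 : ∑' j, s n (j + 1) = ∑' j, s n j := (Equiv.addRight (1 : ℤ)).tsum_eq (s n)
    have s1 : Summable fun j => s n (j - 1) :=
      (Equiv.subRight (1 : ℤ)).summable_iff.mpr (hsum n)
    have s2 : Summable fun j => s n (j + 1) :=
      (Equiv.addRight (1 : ℤ)).summable_iff.mpr (hsum n)
    rw [← tsum_mul_left, tsum_congr (hterm n),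
      Summable.tsum_sub (((hsum n).mul_left _).sub (s1.mul_left _)) (s2.mul_left _),
      Summable.tsum_sub ((hsum n).mul_left _) (s1.mul_left _),
      tsum_mul_left, tsum_mul_left, tsum_mul_left, h1, h2]
    rw [show p ^ (2 * n + 1) = (p ^ n) ^ 2 * p by ring, pow_succ p n]
    field_simp
    ring
  have hfin : ∀ n : ℕ, ∑' j, s n j = invQ p (2 * n) *
      ((∏ k ∈ Finset.range n, (1 - p ^ (k + 1) * u)) *
        ∏ k ∈ Finset.range n, (1 - p ^ (k + 1) * (p * u)⁻¹)) := by
    intro n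
    induction n with
    | zero =>
      rw [tsum_eq_single 0]
      · simp [hsdef, he0, invQ_zero]
      · intro j hj
        simp only [hsdef]
        rcases lt_or_gt_of_ne hj with h | h
        · rw [invQ_neg p (m := ((0 : ℕ) : ℤ) + j) (by push_cast; omega)]; simp
        · rw [invQ_neg p (m := ((0 : ℕ) : ℤ) - j) (by push_cast; omega)]; simp
    | succ n ih =>
      have h := hrec n
      have n1 := one_sub_pow_ne_s2 hp (2 * n)
      have n2 := one_sub_pow_ne_s2 hp (2 * n + 1)
      have q1 := invQ_step hp (2 * (n : ℤ) + 1)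
      have q2 := invQ_step hp (2 * (n : ℤ) + 2)
      rw [show 2 * (n : ℤ) + 1 - 1 = 2 * n by ring] at q1
      rw [show 2 * (n : ℤ) + 2 - 1 = 2 * n + 1 by ring] at q2
      have z1 : p ^ (2 * (n : ℤ) + 1) = p ^ (2 * n + 1) := by
        exact_mod_cast zpow_natCast p (2 * n + 1)
      have z2 : p ^ (2 * (n : ℤ) + 2) = p ^ (2 * n + 2) := by
        exact_mod_cast zpow_natCast p (2 * n + 2)
      rw [z1, q2, z2] at q1
      have hq : p ^ (n + 1) * (p * u)⁻¹ = p ^ n * u⁻¹ := by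
        rw [pow_succ]; field_simp
      rw [ih, q1] at h
      apply mul_left_cancel₀ (mul_ne_zero n1 n2)
      rw [show 2 * n + 1 + 1 = 2 * n + 2 by ring, h, Finset.prod_range_succ,
        Finset.prod_range_succ, hq]
      push_cast
      rw [show 2 * ((n : ℤ) + 1) = 2 * n + 2 by ring]
      ring
  have hlim2 : Tendsto (fun n => ∑' j, s n j) atTop
      (𝓝 ((eulerPr p 1)⁻¹ * (eulerPr p u * eulerPr p (p * u)⁻¹))) := by
    simp only [hfin]
    refine Tendsto.mul ((invQ_tendsto hp).comp ?_)
      ((eulerPr_tendsto hp u).mul (eulerPr_tendsto hp _))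
    exact Tendsto.const_mul_atTop' (by norm_num) tendsto_natCast_atTop_atTop
  have := tendsto_nhds_unique hlim hlim2
  rw [tsum_mul_right] at this
  have hC := eulerPr_one_ne hp
  field_simp at this
  rw [this, one_div, mul_assoc]

/-- The product formula for `jacobiTheta1`. -/
lemma jacobiTheta1_product (t τ : ℂ) (hτ : 0 < τ.im) :
    jacobiTheta1 t τ = -cexp (Real.pi * I * τ / 4 + Real.pi * I * (t + 1 / 2)) *
      (eulerPr (cexp (2 * Real.pi * I * τ)) 1 *
        (eulerPr (cexp (2 * Real.pi * I * τ)) (cexp (2 * Real.pi * I * t)) *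
          eulerPr (cexp (2 * Real.pi * I * τ))
            (cexp (2 * Real.pi * I * τ) * cexp (2 * Real.pi * I * t))⁻¹)) := by
  have hp : ‖cexp (2 * Real.pi * I * τ)‖ < 1 := by
    rw [Complex.norm_exp, Real.exp_lt_one_iff]
    simp
    positivity
  rw [← triple_product hp (exp_ne_zero _) (exp_ne_zero _)
    (fun j => jacobiTheta₂_term j (t + 1 / 2 + τ / 2) τ), jacobiTheta1, neg_mul,
    ← tsum_mul_left]
  · congr 1
    refine tsum_congr fun j => ?_
    rw [jacobiTheta₂_term, ← Complex.exp_add]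
    congr 1
    ring
  · simp [jacobiTheta₂_term]
  · intro j
    have hm : (-1 : ℂ) = cexp (Real.pi * I) := by rw [exp_pi_mul_I]
    rw [neg_mul, neg_mul, neg_eq_neg_one_mul, hm, ← exp_int_mul, jacobiTheta₂_term,
      jacobiTheta₂_term, ← Complex.exp_add, ← Complex.exp_add, ← Complex.exp_add]
    congr 1
    push_cast
    ring
  · exact ((summable_jacobiTheta₂_term_iff _ _).mpr hτ).norm

lemma jacobiTheta1_shift (t τ : ℂ) (m n : ℤ) :
    jacobiTheta1 (t + (m + n * τ)) τ =
      cexp (-(Real.pi * I * n ^ 2 * τ) - 2 * Real.pi * I * n * (t + 1 / 2) + Real.pi * I * m) *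
        jacobiTheta1 t τ := by
  rw [jacobiTheta1, jacobiTheta1, mul_neg, ← tsum_mul_left]
  congr 1
  rw [← (Equiv.addRight n).tsum_eq (fun j : ℤ => cexp (-(Real.pi * I * n ^ 2 * τ) -
    2 * Real.pi * I * n * (t + 1 / 2) + Real.pi * I * m) * cexp (Real.pi * I * (j + 1/2) ^ 2 * τ +
    2 * Real.pi * I * (j + 1/2) * (t + 1/2)))]
  refine tsum_congr fun j => ?_
  rw [Equiv.coe_addRight, ← Complex.exp_add, Complex.exp_eq_exp_iff_exists_int]
  refine ⟨j * m, ?_⟩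
  push_cast
  ring

lemma jacobiTheta1_hasDerivAt_zero (τ : ℂ) (hτ : 0 < τ.im) :
    ∃ d : ℂ, d ≠ 0 ∧ HasDerivAt (fun t => jacobiTheta1 t τ) d 0 := by
  have hp : ‖cexp (2 * Real.pi * I * τ)‖ < 1 := by
    rw [Complex.norm_exp, Real.exp_lt_one_iff]
    simp
    positivity
  set p := cexp (2 * Real.pi * I * τ) with hpdef
  have hp0 : p ≠ 0 := exp_ne_zero _
  set h : ℂ → ℂ := fun t => -cexp (Real.pi * I * τ / 4 + Real.pi * I * (t + 1 / 2)) *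
      (eulerPr p 1 * (eulerPr p (cexp (2 * Real.pi * I * t)) *
        eulerPr p (cexp (-(2 * Real.pi * I * t))))) with hh
  have hfun : (fun t => jacobiTheta1 t τ) =
      fun t => (1 - cexp (-(2 * Real.pi * I * t))) * h t := by
    funext t
    have e1 : p * (p * cexp (2 * Real.pi * I * t))⁻¹ = cexp (-(2 * Real.pi * I * t)) := by
      rw [Complex.exp_neg]; field_simp
    rw [jacobiTheta1_product t τ hτ, ← hpdef, eulerPr_step hp (p * cexp (2 * Real.pi * I * t))⁻¹,
      e1]
    simp only [hh]
    ring
  have hE : DifferentiableAt ℂ (eulerPr p) 1 :=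
    (eulerPr_differentiableOn hp).differentiableAt (Metric.isOpen_ball.mem_nhds (by simp))
  have d1 : DifferentiableAt ℂ (fun t : ℂ => eulerPr p (cexp (2 * Real.pi * I * t))) 0 := by
    refine DifferentiableAt.comp (g := eulerPr p) (0 : ℂ) (by simpa using hE) (by fun_prop)
  have d2 : DifferentiableAt ℂ (fun t : ℂ => eulerPr p (cexp (-(2 * Real.pi * I * t)))) 0 := by
    refine DifferentiableAt.comp (g := eulerPr p) (0 : ℂ) (by simpa using hE) (by fun_prop)
  have hd : DifferentiableAt ℂ h 0 := by
    refine DifferentiableAt.mul (by fun_prop) ((d1.mul d2).const_mul _)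
  have hne : h 0 ≠ 0 := by
    simp only [hh, mul_zero, neg_zero, Complex.exp_zero]
    have := eulerPr_one_ne hp
    exact mul_ne_zero (neg_ne_zero.mpr (exp_ne_zero _)) (mul_ne_zero this (mul_ne_zero this this))
  have hf : HasDerivAt (fun t : ℂ => 1 - cexp (-(2 * Real.pi * I * t))) (2 * Real.pi * I) 0 := by
    have := (((hasDerivAt_id (0 : ℂ)).const_mul (2 * Real.pi * I)).neg.cexp).const_sub 1
    simpa using this
  refine ⟨2 * Real.pi * I * h 0, mul_ne_zero two_pi_I_ne_zero hne, ?_⟩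
  rw [hfun]
  have := hf.fun_mul hd.hasDerivAt
  simpa using this

/-- For Im τ > 0, the zero set of `t ↦ θ(t,τ)` is exactly the lattice `ℤ + τℤ`,
and every zero is simple: the `t`-derivative is nonzero at each lattice point. -/
theorem jacobiTheta1_zeros (τ : ℂ) (hτ : 0 < τ.im) :
    (∀ t : ℂ, jacobiTheta1 t τ = 0 ↔ ∃ m n : ℤ, t = (m : ℂ) + (n : ℂ) * τ) ∧
    (∀ m n : ℤ, deriv (fun t => jacobiTheta1 t τ) ((m : ℂ) + (n : ℂ) * τ) ≠ 0) := by
  have hp : ‖cexp (2 * Real.pi * I * τ)‖ < 1 := by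
    rw [Complex.norm_exp, Real.exp_lt_one_iff]
    simp
    positivity
  have hz : jacobiTheta1 0 τ = 0 := by
    have h0 : eulerPr (cexp (2 * Real.pi * I * τ))
        (cexp (2 * Real.pi * I * τ) * cexp (2 * Real.pi * I * 0))⁻¹ = 0 :=
      (eulerPr_eq_zero_iff hp _).mpr ⟨0, by simp⟩
    rw [jacobiTheta1_product 0 τ hτ, h0]
    simp
  have h2 := two_pi_I_ne_zero
  constructor
  · intro t
    constructor
    · intro h
      rw [jacobiTheta1_product t τ hτ] at h
      have hC := eulerPr_one_ne hp
      have hE := exp_ne_zero (Real.pi * I * τ / 4 + Real.pi * I * (t + 1 / 2))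
      simp only [mul_eq_zero, neg_eq_zero, hC, hE, false_or] at h
      rw [eulerPr_eq_zero_iff hp, eulerPr_eq_zero_iff hp] at h
      rcases h with ⟨k, hk⟩ | ⟨k, hk⟩
      · rw [← Complex.exp_nat_mul, ← Complex.exp_add, Complex.exp_eq_one_iff] at hk
        obtain ⟨n, hn⟩ := hk
        refine ⟨n, -(k + 1), mul_left_cancel₀ h2 ?_⟩
        push_cast at hn ⊢
        linear_combination hn
      · rw [← Complex.exp_nat_mul, ← Complex.exp_add, ← Complex.exp_neg, ← Complex.exp_add,
          Complex.exp_eq_one_iff] at hk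
        obtain ⟨n, hn⟩ := hk
        refine ⟨-n, k, mul_left_cancel₀ h2 ?_⟩
        push_cast at hn ⊢
        linear_combination -hn
    · rintro ⟨m, n, rfl⟩
      have := jacobiTheta1_shift 0 τ m n
      rw [zero_add] at this
      rw [this, hz, mul_zero]
  · intro m n
    obtain ⟨d, hd0, hd⟩ := jacobiTheta1_hasDerivAt_zero τ hτ
    set w : ℂ := m + n * τ with hw
    set E : ℂ → ℂ := fun t => cexp (-(Real.pi * I * n ^ 2 * τ) -
      2 * Real.pi * I * n * (t + 1 / 2) + Real.pi * I * m) with hEdef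
    have hE : DifferentiableAt ℂ E 0 := by fun_prop
    have h1 := hE.hasDerivAt.mul hd
    have h3 : HasDerivAt (fun t => jacobiTheta1 (t + w) τ) (E 0 * d) 0 := by
      have h4 : (fun t => jacobiTheta1 (t + w) τ) = E * fun t => jacobiTheta1 t τ := by
        funext t
        exact jacobiTheta1_shift t τ m n
      rw [h4]
      simpa [hz] using h1
    have h5 : deriv (fun t => jacobiTheta1 t τ) w = E 0 * d := by
      have := deriv_comp_add_const (fun t => jacobiTheta1 t τ) w 0
      rw [zero_add] at this
      rw [← this]
      exact h3.deriv
    rw [h5]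
    exact mul_ne_zero (exp_ne_zero _) hd0
end

section
/- Let τ ∈ ℂ with Im τ > 0 and η, Λ, M, z, λ ∈ ℂ be such that all the theta-quotients below are defined. Let R^{kl}_{ij}(z,λ;Λ,M) (i,j,k,l ∈ {0,1}, i+j = k+l = 1) be the one-excitation R-matrix entries, and let R^{kl}_{ij}(z,λ;M,Λ) denote the same expressions with Λ and M interchanged. Then the unitarity relation R_{Λ,M}(z,λ)^{(12)} R_{M,Λ}(−z,λ)^{(21)} = Id holds on the one-excitation subspace, i.e. for all weight-one index pairs (p,q) and (i,j) with p+q = i+j = 1: ∑_{(k,l), k+l=1} R^{pq}_{lk}(z,λ;Λ,M) · R^{kl}_{ji}(−z,λ;M,Λ) = δ_{(p,q),(i,j)}. -/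
open Complex

/-- One-excitation R-matrix entries `R^{kl}_{ij}(z,λ;Λ,M)` (modulus `τ`,
Planck constant `η`); zero outside the weight-one index pairs. -/
noncomputable def Rone (τ η Λ M z lam : ℂ) (k l i j : Fin 2) : ℂ :=
  if k = 0 ∧ l = 1 then
    (if i = 0 ∧ j = 1 then
      jacobiTheta1 (z + η * Λ - η * M) τ * jacobiTheta1 (lam + 2 * η) τ /
        (jacobiTheta1 (z - η * Λ - η * M) τ * jacobiTheta1 (lam + 2 * η * (1 - Λ)) τ)
    else if i = 1 ∧ j = 0 then
      -(jacobiTheta1 (lam + 2 * η + z - η * Λ - η * M) τ * jacobiTheta1 (2 * η * Λ) τ /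
        (jacobiTheta1 (z - η * Λ - η * M) τ * jacobiTheta1 (lam + 2 * η * (1 - Λ)) τ))
    else 0)
  else if k = 1 ∧ l = 0 then
    (if i = 0 ∧ j = 1 then
      -(jacobiTheta1 (lam + 2 * η - z - η * Λ - η * M) τ * jacobiTheta1 (2 * η * M) τ /
        (jacobiTheta1 (z - η * Λ - η * M) τ * jacobiTheta1 (lam + 2 * η * (1 - Λ)) τ))
    else if i = 1 ∧ j = 0 then
      jacobiTheta1 (z + η * M - η * Λ) τ * jacobiTheta1 (lam + 2 * η * (1 - Λ - M)) τ /
        (jacobiTheta1 (z - η * Λ - η * M) τ * jacobiTheta1 (lam + 2 * η * (1 - Λ)) τ)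
    else 0)
  else 0

/-- General term of a theta series with characteristic `c`. -/
noncomputable def thTerm (c τ w : ℂ) (a : ℤ) : ℂ :=
  Complex.exp (Real.pi * I * (a + c) ^ 2 * τ + 2 * Real.pi * I * (a + c) * w)

theorem thTerm_summable (c τ w : ℂ) (hτ : 0 < τ.im) :
    Summable (fun a => ‖thTerm c τ w a‖) := by
  have h := ((summable_jacobiTheta₂_term_iff (w + c * τ) τ).2 hτ).mul_left
    (Complex.exp (Real.pi * I * c ^ 2 * τ + 2 * Real.pi * I * c * w))
  refine (h.congr ?_).norm
  intro a
  rw [thTerm, jacobiTheta₂_term, ← Complex.exp_add]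
  congr 1
  ring

/-- Even-part and odd-part pairs parametrise all pairs. -/
def pairMap : (ℤ × ℤ) ⊕ (ℤ × ℤ) → ℤ × ℤ :=
  Sum.elim (fun p => (p.1 + p.2, p.1 - p.2 - 1)) (fun p => (p.1 + p.2, p.1 - p.2))

theorem pairMap_bij : Function.Bijective pairMap := by
  constructor
  · rintro (⟨a, b⟩ | ⟨a, b⟩) (⟨c, d⟩ | ⟨c, d⟩) h <;>
      simp only [pairMap, Sum.elim_inl, Sum.elim_inr, Prod.mk.injEq] at h
    · obtain ⟨rfl, rfl⟩ : a = c ∧ b = d := by omega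
      rfl
    · omega
    · omega
    · obtain ⟨rfl, rfl⟩ : a = c ∧ b = d := by omega
      rfl
  · rintro ⟨j, k⟩
    rcases Int.even_or_odd' (j + k) with ⟨m, hm | hm⟩
    · refine ⟨Sum.inr (m, j - m), ?_⟩
      simp only [pairMap, Sum.elim_inr, Prod.mk.injEq]
      omega
    · refine ⟨Sum.inl (m + 1, j - m - 1), ?_⟩
      simp only [pairMap, Sum.elim_inl, Prod.mk.injEq]
      omega

theorem theta_prod (τ x y : ℂ) (hτ : 0 < τ.im) :
    jacobiTheta1 (x + y) τ * jacobiTheta1 (x - y) τ =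
      (∑' a, thTerm 0 (2 * τ) (2 * x) a) * (∑' a, thTerm (1/2) (2 * τ) (2 * y) a) -
      (∑' a, thTerm (1/2) (2 * τ) (2 * x) a) * (∑' a, thTerm 0 (2 * τ) (2 * y) a) := by
  have hτ2 : 0 < (2 * τ).im := by simpa using hτ
  have hs := fun c w => thTerm_summable c τ w hτ
  have hs2 := fun c w => thTerm_summable c (2 * τ) w hτ2
  have hth : ∀ t, jacobiTheta1 t τ = -∑' a, thTerm (1/2) τ (t + 1/2) a := fun t => rfl
  rw [hth, hth, neg_mul_neg, tsum_mul_tsum_of_summable_norm (hs _ _) (hs _ _),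
    tsum_mul_tsum_of_summable_norm (hs2 _ _) (hs2 _ _),
    tsum_mul_tsum_of_summable_norm (hs2 _ _) (hs2 _ _)]
  have hE := (summable_mul_of_summable_norm (hs2 0 (2 * x)) (hs2 (1/2) (2 * y))).hasSum
  have hO := (summable_mul_of_summable_norm (hs2 (1/2) (2 * x)) (hs2 0 (2 * y))).hasSum.neg
  rw [← (Equiv.ofBijective _ pairMap_bij).tsum_eq]
  refine Eq.trans (HasSum.tsum_eq (HasSum.sum ?_ ?_)) (sub_eq_add_neg _ _).symm
  · refine Eq.subst (motive := fun f => HasSum f _) ?_ hE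
    funext ⟨a, b⟩
    simp only [Function.comp, Equiv.ofBijective_apply, pairMap, Sum.elim_inl, thTerm]
    symm
    rw [← Complex.exp_add, ← Complex.exp_add, Complex.exp_eq_exp_iff_exists_int]
    refine ⟨a, ?_⟩
    push_cast
    ring
  · refine Eq.subst (motive := fun f => HasSum f _) ?_ hO
    funext ⟨a, b⟩
    simp only [Function.comp, Equiv.ofBijective_apply, pairMap, Sum.elim_inr, thTerm]
    symm
    rw [← Complex.exp_add, ← Complex.exp_add, ← neg_one_mul, ← Complex.exp_pi_mul_I,
      ← Complex.exp_add, Complex.exp_eq_exp_iff_exists_int]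
    refine ⟨a, ?_⟩
    push_cast
    ring

theorem theta_odd (τ s t : ℂ) (hτ : 0 < τ.im) (hs : jacobiTheta1 s τ ≠ 0) :
    jacobiTheta1 (-t) τ = -jacobiTheta1 t τ := by
  have h1 := theta_prod τ ((s + t) / 2) ((s - t) / 2) hτ
  have h2 := theta_prod τ ((s - t) / 2) ((s + t) / 2) hτ
  rw [show (s + t) / 2 + (s - t) / 2 = s by ring,
    show (s + t) / 2 - (s - t) / 2 = t by ring] at h1
  rw [show (s - t) / 2 + (s + t) / 2 = s by ring,
    show (s - t) / 2 - (s + t) / 2 = -t by ring] at h2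
  apply mul_left_cancel₀ hs
  linear_combination h1 + h2

theorem theta_three (τ w z s d : ℂ) (hτ : 0 < τ.im) :
    (jacobiTheta1 (w + z) τ * jacobiTheta1 (w - z) τ) *
      (jacobiTheta1 (s + d) τ * jacobiTheta1 (s - d) τ) +
    (jacobiTheta1 (d + z) τ * jacobiTheta1 (d - z) τ) *
      (jacobiTheta1 (w + s) τ * jacobiTheta1 (w - s) τ) =
    (jacobiTheta1 (s + z) τ * jacobiTheta1 (s - z) τ) *
      (jacobiTheta1 (w + d) τ * jacobiTheta1 (w - d) τ) := by
  simp only [theta_prod _ _ _ hτ]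
  ring

/-- Unitarity `R_{Λ,M}(z,λ)^{(12)} R_{M,Λ}(−z,λ)^{(21)} = Id` on the
one-excitation subspace:
`∑_{(k,l),k+l=1} R^{pq}_{lk}(z,λ;Λ,M) R^{kl}_{ji}(−z,λ;M,Λ) = δ_{(p,q),(i,j)}`. -/
theorem Rone_unitarity (τ η Λ M z lam : ℂ) (hτ : 0 < τ.im)
    (hd1 : jacobiTheta1 (z - η * Λ - η * M) τ ≠ 0)
    (hd2 : jacobiTheta1 (lam + 2 * η * (1 - Λ)) τ ≠ 0)
    (hd3 : jacobiTheta1 (-z - η * M - η * Λ) τ ≠ 0)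
    (hd4 : jacobiTheta1 (lam + 2 * η * (1 - M)) τ ≠ 0) :
    ∀ p q i j : Fin 2, (p : ℕ) + (q : ℕ) = 1 → (i : ℕ) + (j : ℕ) = 1 →
      (∑ kl : Fin 2 × Fin 2,
        if ((kl.1 : ℕ) + (kl.2 : ℕ) = 1) then
          Rone τ η Λ M z lam p q kl.2 kl.1 * Rone τ η M Λ (-z) lam kl.1 kl.2 j i
        else 0) =
      (if p = i ∧ q = j then 1 else 0) := by
  have odd := fun t => theta_odd τ _ t hτ hd1
  have key := theta_three τ (lam + 2 * η - η * Λ - η * M) z (η * Λ + η * M) (η * Λ - η * M) hτ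
  rw [show lam + 2 * η - η * Λ - η * M + z = lam + 2 * η + z - η * Λ - η * M by ring,
    show lam + 2 * η - η * Λ - η * M - z = lam + 2 * η - z - η * Λ - η * M by ring,
    show η * Λ + η * M + (η * Λ - η * M) = 2 * η * Λ by ring,
    show η * Λ + η * M - (η * Λ - η * M) = 2 * η * M by ring,
    show η * Λ - η * M + z = z + η * Λ - η * M by ring,
    show η * Λ - η * M - z = -(z + η * M - η * Λ) by ring, odd,
    show lam + 2 * η - η * Λ - η * M + (η * Λ + η * M) = lam + 2 * η by ring,
    show lam + 2 * η - η * Λ - η * M - (η * Λ + η * M) = lam + 2 * η * (1 - Λ - M) by ring,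
    show η * Λ + η * M + z = -(-z - η * M - η * Λ) by ring, odd,
    show η * Λ + η * M - z = -(z - η * Λ - η * M) by ring, odd,
    show lam + 2 * η - η * Λ - η * M + (η * Λ - η * M) = lam + 2 * η * (1 - M) by ring,
    show lam + 2 * η - η * Λ - η * M - (η * Λ - η * M) = lam + 2 * η * (1 - Λ) by ring] at key
  have e1 : jacobiTheta1 (-z + η * M - η * Λ) τ = -jacobiTheta1 (z + η * Λ - η * M) τ := by
    rw [← odd]; congr 1; ring
  have e2 : jacobiTheta1 (-z + η * Λ - η * M) τ = -jacobiTheta1 (z + η * M - η * Λ) τ := by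
    rw [← odd]; congr 1; ring
  have e3 : jacobiTheta1 (lam + 2 * η + -z - η * M - η * Λ) τ =
      jacobiTheta1 (lam + 2 * η - z - η * Λ - η * M) τ := by congr 1; ring
  have e4 : jacobiTheta1 (lam + 2 * η + z - η * M - η * Λ) τ =
      jacobiTheta1 (lam + 2 * η + z - η * Λ - η * M) τ := by congr 1; ring
  have e5 : jacobiTheta1 (lam + 2 * η * (1 - M - Λ)) τ =
      jacobiTheta1 (lam + 2 * η * (1 - Λ - M)) τ := by congr 1; ring
  intro p q i j hpq hij
  fin_cases p <;> fin_cases q <;> simp at hpq <;> fin_cases i <;> fin_cases j <;>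
    simp at hij <;> simp [Fintype.sum_prod_type, Rone, e1, e2, e3, e4, e5]
  all_goals
    clear e1 e2 e3 e4 e5 odd
    generalize jacobiTheta1 (z + η * Λ - η * M) τ = t0 at *
    generalize jacobiTheta1 (z + η * M - η * Λ) τ = t1 at *
    generalize jacobiTheta1 (lam + 2 * η) τ = t2 at *
    generalize jacobiTheta1 (lam + 2 * η * (1 - Λ - M)) τ = t3 at *
    generalize jacobiTheta1 (z - η * Λ - η * M) τ = t4 at *
    generalize jacobiTheta1 (-z - η * M - η * Λ) τ = t5 at *
    generalize jacobiTheta1 (lam + 2 * η * (1 - M)) τ = t6 at *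
    generalize jacobiTheta1 (lam + 2 * η * (1 - Λ)) τ = t7 at *
    generalize jacobiTheta1 (lam + 2 * η + z - η * Λ - η * M) τ = t8 at *
    generalize jacobiTheta1 (lam + 2 * η - z - η * Λ - η * M) τ = t9 at *
    generalize jacobiTheta1 (2 * η * Λ) τ = t10 at *
    generalize jacobiTheta1 (2 * η * M) τ = t11 at *
    field_simp
  all_goals first | ring1 | linear_combination key
end

section
/- Let τ ∈ ℂ with Im τ > 0, η ∈ ℂ, Λ₁,…,Λₙ ∈ ℂ with a_k = ηΛ_k, z₁,…,zₙ ∈ ℂ, λ ∈ ℂ, and m₁,…,mₙ nonnegative integers with m = m₁+…+mₙ. Then the weight function f = ω_{m₁,…,mₙ}(·,λ;z;τ) lies in F^m_{a₁,…,aₙ}(z₁,…,zₙ,λ), i.e.: (i) the function ∏_{i<j} θ(t_i−t_j+2η) · ∏_{i=1}^m ∏_{k=1}^n θ(t_i−z_k−a_k) · f(t₁,…,t_m) extends to a holomorphic function on ℂ^m (in particular the apparent poles of the individual summands along t_i = t_j cancel); (ii) f is 1-periodic in each variable t_j and f(…,t_j+τ,…) = e^{−2πi(λ+4ηj−2η)}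 f(…,t_j,…) for each j = 1,…,m; (iii) f is invariant under the twisted symmetric group action: f(…,t_{j+1},t_j,…) · θ(t_j−t_{j+1}−2η)/θ(t_j−t_{j+1}+2η) = f(t₁,…,t_m) for each j = 1,…,m−1. -/
open Complex Finset

/-- `u(t) = ∏_{i<j} θ(t_i−t_j+2η)/θ(t_i−t_j)`. -/
noncomputable def uFn (τ η : ℂ) {m : ℕ} (t : Fin m → ℂ) : ℂ :=
  ∏ i : Fin m, ∏ j : Fin m,
    if i < j then jacobiTheta1 (t i - t j + 2 * η) τ / jacobiTheta1 (t i - t j) τ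
    else 1

open scoped Classical in
/-- The weight function `ω_{m₁,…,mₙ}(t₁,…,t_m,λ;z;τ)` (with `a_k = ηΛ_k`);
the sum over tuples of disjoint subsets `I₁,…,Iₙ` with `|I_k| = m_k` is encoded
as a sum over maps `σ : Fin m → Fin n` with fibers of cardinalities `m_k`
(`I_k = σ⁻¹(k)`). -/
noncomputable def weightFn (τ η lam : ℂ) {n m : ℕ} (Λ z : Fin n → ℂ)
    (mv : Fin n → ℕ) (t : Fin m → ℂ) : ℂ :=
  (uFn τ η t)⁻¹ *
    ∑ σ : Fin m → Fin n,
      if ∀ k : Fin n, (Finset.univ.filter fun i => σ i = k).card = mv k then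
        (∏ i : Fin m, ∏ k : Fin n,
          if k < σ i then
            jacobiTheta1 (t i - z k + η * Λ k) τ /
              jacobiTheta1 (t i - z k - η * Λ k) τ
          else 1) *
        (∏ i : Fin m, ∏ j : Fin m,
          if σ i < σ j then
            jacobiTheta1 (t i - t j + 2 * η) τ / jacobiTheta1 (t i - t j) τ
          else 1) *
        (∏ j : Fin m,
          jacobiTheta1 (lam + t j - z (σ j) - η * Λ (σ j) + 2 * η * (mv (σ j) : ℂ) -
              2 * η * ∑ l ∈ Finset.univ.filter (fun l : Fin n => l < σ j),
                (Λ l - 2 * (mv l : ℂ))) τ /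
            jacobiTheta1 (t j - z (σ j) - η * Λ (σ j)) τ)
      else 0

/-- All theta-denominators occurring in the weight function are nonzero at `t`. -/
def wfDefined (τ η : ℂ) {n m : ℕ} (Λ z : Fin n → ℂ) (t : Fin m → ℂ) : Prop :=
  (∀ i j : Fin m, i ≠ j → jacobiTheta1 (t i - t j) τ ≠ 0) ∧
  (∀ i j : Fin m, i ≠ j → jacobiTheta1 (t i - t j + 2 * η) τ ≠ 0) ∧
  (∀ (i : Fin m) (k : Fin n), jacobiTheta1 (t i - z k - η * Λ k) τ ≠ 0)


theorem th_eq (t τ : ℂ) : jacobiTheta1 t τ =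
    -(Complex.exp (Real.pi * I * τ / 4 + Real.pi * I * (t + 1/2)) *
      jacobiTheta₂ (t + 1/2 + τ/2) τ) := by
  unfold jacobiTheta1 jacobiTheta₂
  rw [← tsum_mul_left]
  congr 1
  apply tsum_congr
  intro j
  unfold jacobiTheta₂_term
  rw [← Complex.exp_add]
  congr 1
  ring

theorem th_odd (t τ : ℂ) : jacobiTheta1 (-t) τ = - jacobiTheta1 t τ := by
  unfold jacobiTheta1
  rw [← (Equiv.subLeft (-1 : ℤ)).tsum_eq, ← tsum_neg, neg_neg]
  apply tsum_congr
  intro j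
  have h : (Real.pi * I * (((Equiv.subLeft (-1 : ℤ)) j : ℤ) + 1/2) ^ 2 * τ +
    2 * Real.pi * I * (((Equiv.subLeft (-1 : ℤ)) j : ℤ) + 1/2) * (-t + 1/2) : ℂ) =
    (Real.pi * I * (j + 1/2) ^ 2 * τ + 2 * Real.pi * I * (j + 1/2) * (t + 1/2)) +
      (-(Real.pi * I)  + ((-j : ℤ) : ℂ) * (2 * Real.pi * I)) := by
    simp only [Equiv.subLeft_apply]
    push_cast
    ring
  rw [h, Complex.exp_add, Complex.exp_add (-(Real.pi * I : ℂ)), Complex.exp_int_mul_two_pi_mul_I, Complex.exp_neg,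
    Complex.exp_pi_mul_I]
  norm_num

theorem th_one (t τ : ℂ) : jacobiTheta1 (t + 1) τ = - jacobiTheta1 t τ := by
  rw [th_eq, th_eq, show t + 1 + 1/2 + τ/2 = (t + 1/2 + τ/2) + 1 by ring, jacobiTheta₂_add_left,
    show (Real.pi * I * τ / 4 + Real.pi * I * (t + 1 + 1/2) : ℂ) =
      (Real.pi * I * τ / 4 + Real.pi * I * (t + 1/2)) + Real.pi * I by ring, Complex.exp_add,
    Complex.exp_pi_mul_I]
  ring

theorem th_tau (t τ : ℂ) : jacobiTheta1 (t + τ) τ =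
    - (Complex.exp (-(Real.pi * I * τ) - 2 * Real.pi * I * t) * jacobiTheta1 t τ) := by
  rw [th_eq, th_eq, show t + τ + 1/2 + τ/2 = (t + 1/2 + τ/2) + τ by ring, jacobiTheta₂_add_left']
  have : Complex.exp (Real.pi * I * τ / 4 + Real.pi * I * (t + τ + 1/2)) *
      Complex.exp (-Real.pi * I * (τ + 2 * (t + 1/2 + τ/2))) =
      - (Complex.exp (-(Real.pi * I * τ) - 2 * Real.pi * I * t) *
        Complex.exp (Real.pi * I * τ / 4 + Real.pi * I * (t + 1/2))) := by
    have h1 : Complex.exp (-(Real.pi * I)) = -1 := by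
      rw [Complex.exp_neg, Complex.exp_pi_mul_I]; norm_num
    rw [← Complex.exp_add, ← Complex.exp_add, ← neg_one_mul (Complex.exp _), ← h1,
      ← Complex.exp_add]
    congr 1
    ring
  linear_combination (-jacobiTheta₂ (t + 1/2 + τ/2) τ) * this

theorem th_analytic {τ : ℂ} (hτ : 0 < τ.im) : AnalyticOnNhd ℂ (fun t => jacobiTheta1 t τ) Set.univ := by
  apply DifferentiableOn.analyticOnNhd _ isOpen_univ
  intro t _
  apply DifferentiableAt.differentiableWithinAt
  simp only [th_eq]
  have h2 : DifferentiableAt ℂ (fun t => jacobiTheta₂ (t + 1/2 + τ/2) τ) t :=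
    DifferentiableAt.comp t (f := fun t => t + 1/2 + τ/2) (g := fun x => jacobiTheta₂ x τ)
      (differentiableAt_jacobiTheta₂_fst _ hτ) (by fun_prop)
  have h1 : DifferentiableAt ℂ
      (fun t : ℂ => Complex.exp (Real.pi * I * τ / 4 + Real.pi * I * (t + 1/2))) t := by fun_prop
  exact (h1.mul h2).neg

/-- Quasi-period `w` with multiplier exponent `κ`. -/
def QP (τ w κ : ℂ) : Prop := ∀ a b : ℂ, jacobiTheta1 (a + w) τ / jacobiTheta1 (b + w) τ =
  Complex.exp (κ * (a - b)) * (jacobiTheta1 a τ / jacobiTheta1 b τ)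

theorem qp_one (τ : ℂ) : QP τ 1 0 := by
  intro a b
  simp [th_one]

theorem qp_tau (τ : ℂ) : QP τ τ (-(2 * Real.pi * I)) := by
  intro a b
  rw [th_tau, th_tau, neg_div_neg_eq, mul_div_mul_comm, ← Complex.exp_sub]
  congr 2
  ring

theorem QP.neg {τ w κ : ℂ} (h : QP τ w κ) : QP τ (-w) (-κ) := by
  intro a b
  have := h (a - w) (b - w)
  simp only [sub_add_cancel] at this
  rw [this, ← mul_assoc, ← Complex.exp_add, ← sub_eq_add_neg, ← sub_eq_add_neg]
  ring_nf
  simp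

theorem QP.pair {τ w κ : ℂ} (h : QP τ w κ) (η : ℂ) {m : ℕ} (t : Fin m → ℂ) (j : Fin m)
    (P : Fin m → Fin m → Prop) [∀ a b, Decidable (P a b)] :
    (∏ i : Fin m, ∏ k : Fin m, if P i k then
      jacobiTheta1 (Function.update t j (t j + w) i - Function.update t j (t j + w) k + 2 * η) τ /
      jacobiTheta1 (Function.update t j (t j + w) i - Function.update t j (t j + w) k) τ else 1) =
    Complex.exp (κ * (2 * η) * ((#{k | P j k} : ℂ) - (#{i | P i j} : ℂ))) *
    (∏ i : Fin m, ∏ k : Fin m, if P i k then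
      jacobiTheta1 (t i - t k + 2 * η) τ / jacobiTheta1 (t i - t k) τ else 1) := by
  have key : ∀ i k : Fin m, (if P i k then
      jacobiTheta1 (Function.update t j (t j + w) i - Function.update t j (t j + w) k + 2 * η) τ /
      jacobiTheta1 (Function.update t j (t j + w) i - Function.update t j (t j + w) k) τ else 1) =
      Complex.exp (κ * (2 * η) * ((if i = j then (if P j k then 1 else 0) else 0) -
        (if k = j then (if P i j then 1 else 0) else 0))) *
      (if P i k then jacobiTheta1 (t i - t k + 2 * η) τ / jacobiTheta1 (t i - t k) τ else 1) := by
    intro i k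
    by_cases hi : i = j <;> by_cases hk : k = j
    · subst hi; subst hk; simp
    · subst hi
      simp only [Function.update_self, Function.update_of_ne hk, hk, if_true, if_false, sub_zero]
      split_ifs
      · have := h (t i - t k + 2 * η) (t i - t k)
        rw [show t i + w - t k + 2 * η = t i - t k + 2 * η + w by ring,
          show t i + w - t k = t i - t k + w by ring, this]
        congr 2
        ring
      · simp
    · subst hk
      simp only [Function.update_self, Function.update_of_ne hi, hi, if_true, if_false]
      split_ifs
      · have := h.neg (t i - t k + 2 * η) (t i - t k)
        rw [show t i - (t k + w) + 2 * η = t i - t k + 2 * η + -w by ring,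
          show t i - (t k + w) = t i - t k + -w by ring, this]
        congr 2
        ring
      · simp
    · simp [Function.update_of_ne, hi, hk]
  simp only [key, Finset.prod_mul_distrib, ← Complex.exp_sum, ← Finset.mul_sum]
  congr 3
  simp only [Finset.sum_sub_distrib]
  congr 1
  · rw [Finset.sum_comm]; simp
  · simp

theorem QP.single {ι : Type*} [Fintype ι] [DecidableEq ι] (f : ι → ℂ → ℂ) (t : ι → ℂ) (j : ι) (x c : ℂ)
    (h : f j x = c * f j (t j)) :
    ∏ i, f i (Function.update t j x i) = c * ∏ i, f i (t i) := by
  have : ∀ i, f i (Function.update t j x i) = (if i = j then c else 1) * f i (t i) := by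
    intro i
    by_cases hi : i = j
    · subst hi; simp [h]
    · simp [hi]
  simp only [this, Finset.prod_mul_distrib]
  simp

open scoped Classical in
/-- one summand -/
noncomputable def wTerm (τ η lam : ℂ) {n m : ℕ} (Λ z : Fin n → ℂ)
    (mv : Fin n → ℕ) (t : Fin m → ℂ) (σ : Fin m → Fin n) : ℂ :=
      if ∀ k : Fin n, (Finset.univ.filter fun i => σ i = k).card = mv k then
        (∏ i : Fin m, ∏ k : Fin n,
          if k < σ i then
            jacobiTheta1 (t i - z k + η * Λ k) τ /
              jacobiTheta1 (t i - z k - η * Λ k) τ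
          else 1) *
        (∏ i : Fin m, ∏ j : Fin m,
          if σ i < σ j then
            jacobiTheta1 (t i - t j + 2 * η) τ / jacobiTheta1 (t i - t j) τ
          else 1) *
        (∏ j : Fin m,
          jacobiTheta1 (lam + t j - z (σ j) - η * Λ (σ j) + 2 * η * (mv (σ j) : ℂ) -
              2 * η * ∑ l ∈ Finset.univ.filter (fun l : Fin n => l < σ j),
                (Λ l - 2 * (mv l : ℂ))) τ /
            jacobiTheta1 (t j - z (σ j) - η * Λ (σ j)) τ)
      else 0

theorem weightFn_eq (τ η lam : ℂ) {n m : ℕ} (Λ z : Fin n → ℂ)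
    (mv : Fin n → ℕ) (t : Fin m → ℂ) : weightFn τ η lam Λ z mv t =
    (uFn τ η t)⁻¹ * ∑ σ, wTerm τ η lam Λ z mv t σ := rfl

theorem uFn_shift {τ w κ : ℂ} (h : QP τ w κ) (η : ℂ) {m : ℕ} (t : Fin m → ℂ) (j : Fin m) :
    uFn τ η (Function.update t j (t j + w)) =
      Complex.exp (κ * (2 * η) * (m - 1 - 2 * (j : ℕ))) * uFn τ η t := by
  unfold uFn
  rw [h.pair η t j (fun a b => a < b)]
  congr 3
  have h1 : #{k : Fin m | j < k} = m - 1 - j := by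
    rw [← Fin.card_Ioi]; congr 1; ext; simp
  have h2 : #{k : Fin m | k < j} = j := by
    rw [← Fin.card_Iio]; congr 1; ext; simp
  have h3 : m - 1 - (j : ℕ) + j + 1 = m := by omega
  rw [h1, h2]
  have h4 : ((m - 1 - (j : ℕ) : ℕ) : ℂ) + (j : ℕ) + 1 = m := by exact_mod_cast h3
  linear_combination h4

theorem wTerm_shift {τ w κ : ℂ} (h : QP τ w κ) (η lam : ℂ) {n m : ℕ} (Λ z : Fin n → ℂ)
    (mv : Fin n → ℕ) (t : Fin m → ℂ) (j : Fin m) (σ : Fin m → Fin n) :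
    wTerm τ η lam Λ z mv (Function.update t j (t j + w)) σ =
      Complex.exp (κ * (lam + 2 * η * m)) * wTerm τ η lam Λ z mv t σ := by
  unfold wTerm
  split_ifs with hv
  swap
  · simp
  rw [h.pair η t j (fun a b => σ a < σ b)]
  rw [QP.single (fun i x => ∏ k : Fin n,
          if k < σ i then
            jacobiTheta1 (x - z k + η * Λ k) τ /
              jacobiTheta1 (x - z k - η * Λ k) τ
          else 1) t j (t j + w) (Complex.exp (κ * (2 * η) * ∑ k with k < σ j, Λ k)),
    QP.single (fun i x => jacobiTheta1 (lam + x - z (σ i) - η * Λ (σ i) + 2 * η * (mv (σ i) : ℂ) -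
              2 * η * ∑ l ∈ Finset.univ.filter (fun l : Fin n => l < σ i),
                (Λ l - 2 * (mv l : ℂ))) τ /
            jacobiTheta1 (x - z (σ i) - η * Λ (σ i)) τ) t j (t j + w)
        (Complex.exp (κ * (lam + 2 * η * (mv (σ j) : ℂ) -
              2 * η * ∑ l ∈ Finset.univ.filter (fun l : Fin n => l < σ j),
                (Λ l - 2 * (mv l : ℂ)))))]
  · have hlt : #{i | σ i < σ j} = ∑ l with l < σ j, mv l := by
      simp only [← hv]
      rw [Finset.card_eq_sum_card_fiberwise (f := σ) (t := univ.filter (fun l => l < σ j))]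
      · apply Finset.sum_congr rfl
        intro l hl
        congr 1
        ext i
        simp at hl ⊢
        rintro rfl
        exact hl
      · intro i hi
        simpa using hi
    have htot : #{i | σ j < σ i} + #{i | σ i < σ j} + mv (σ j) = m := by
      rw [← hv (σ j), ← Finset.card_union_of_disjoint, ← Finset.card_union_of_disjoint]
      · convert Finset.card_fin m
        ext i
        simp
        rcases lt_trichotomy (σ i) (σ j) with h | h | h <;> simp [h]
      · rw [Finset.disjoint_left]
        intro i
        simp only [Finset.mem_union, Finset.mem_filter, Finset.mem_univ, true_and]
        rintro (h | h) h' <;> order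
      · rw [Finset.disjoint_left]
        intro i
        simp
        intro h; order
    have htot' : (#{i | σ j < σ i} : ℂ) + (#{i | σ i < σ j} : ℂ) + mv (σ j) = m := by
      exact_mod_cast htot
    have hlt' : (#{i | σ i < σ j} : ℂ) = ∑ l with l < σ j, (mv l : ℂ) := by
      rw [hlt]; push_cast; rfl
    have hexp : Complex.exp (κ * (lam + 2 * η * m)) =
      Complex.exp (κ * (2 * η) * ∑ k with k < σ j, Λ k) *
      Complex.exp (κ * (2 * η) * ((#{k | σ j < σ k} : ℂ) - (#{i | σ i < σ j} : ℂ))) *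
      (Complex.exp (κ * (lam + 2 * η * (mv (σ j) : ℂ) -
              2 * η * ∑ l ∈ Finset.univ.filter (fun l : Fin n => l < σ j),
                (Λ l - 2 * (mv l : ℂ))))) := by
      rw [← Complex.exp_add, ← Complex.exp_add]
      congr 1
      rw [Finset.sum_sub_distrib, ← Finset.mul_sum]
      linear_combination -κ * (2 * η) * htot' + 2 * κ * (2 * η) * hlt'
    rw [hexp]
    ring
  · have := h (lam + t j - z (σ j) - η * Λ (σ j) + 2 * η * (mv (σ j) : ℂ) -
              2 * η * ∑ l ∈ Finset.univ.filter (fun l : Fin n => l < σ j),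
                (Λ l - 2 * (mv l : ℂ))) (t j - z (σ j) - η * Λ (σ j))
    convert this using 3 <;> ring_nf
  · simp only [Finset.mul_sum]
    rw [Finset.sum_filter, Complex.exp_sum, ← Finset.prod_mul_distrib]
    apply Finset.prod_congr rfl
    intro k _
    split_ifs
    · have := h (t j - z k + η * Λ k) (t j - z k - η * Λ k)
      convert this using 3 <;> ring_nf
    · simp

theorem weightFn_shift {τ w κ : ℂ} (h : QP τ w κ) (η lam : ℂ) {n m : ℕ} (Λ z : Fin n → ℂ)
    (mv : Fin n → ℕ) (t : Fin m → ℂ) (j : Fin m) :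
    weightFn τ η lam Λ z mv (Function.update t j (t j + w)) =
      Complex.exp (κ * (lam + 4 * η * (((j : ℕ) : ℂ) + 1) - 2 * η)) *
        weightFn τ η lam Λ z mv t := by
  rw [weightFn_eq, weightFn_eq, uFn_shift h]
  simp only [wTerm_shift h]
  rw [← Finset.mul_sum, mul_inv, ← Complex.exp_neg]
  have : Complex.exp (κ * (lam + 4 * η * (((j : ℕ) : ℂ) + 1) - 2 * η)) =
    Complex.exp (-(κ * (2 * η) * (m - 1 - 2 * (j : ℕ)))) * Complex.exp (κ * (lam + 2 * η * m)) := by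
    rw [← Complex.exp_add]
    congr 1
    ring
  rw [this]
  ring

theorem wTerm_perm (τ η lam : ℂ) {n m : ℕ} (Λ z : Fin n → ℂ)
    (mv : Fin n → ℕ) (t : Fin m → ℂ) (σ : Fin m → Fin n) (e : Equiv.Perm (Fin m)) :
    wTerm τ η lam Λ z mv (t ∘ e) (σ ∘ e) = wTerm τ η lam Λ z mv t σ := by
  unfold wTerm
  have hc : ∀ k, #{i | (σ ∘ e) i = k} = #{i | σ i = k} := by
    intro k
    simp only [Finset.card_filter]
    exact Equiv.sum_comp e (fun i => if σ i = k then 1 else 0)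
  simp only [hc]
  congr 1
  congr 1
  · congr 1
    · exact Equiv.prod_comp e (fun i => ∏ k : Fin n,
          if k < σ i then
            jacobiTheta1 (t i - z k + η * Λ k) τ /
              jacobiTheta1 (t i - z k - η * Λ k) τ
          else 1)
    · rw [← Equiv.prod_comp e (fun i => ∏ j : Fin m, if σ i < σ j then
            jacobiTheta1 (t i - t j + 2 * η) τ / jacobiTheta1 (t i - t j) τ
          else 1)]
      apply Finset.prod_congr rfl
      intro i _
      exact Equiv.prod_comp e (fun j => if σ (e i) < σ j then
            jacobiTheta1 (t (e i) - t j + 2 * η) τ / jacobiTheta1 (t (e i) - t j) τ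
          else 1)
  · exact Equiv.prod_comp e (fun j => jacobiTheta1 (lam + t j - z (σ j) - η * Λ (σ j) + 2 * η * (mv (σ j) : ℂ) -
              2 * η * ∑ l ∈ Finset.univ.filter (fun l : Fin n => l < σ j),
                (Λ l - 2 * (mv l : ℂ))) τ /
            jacobiTheta1 (t j - z (σ j) - η * Λ (σ j)) τ)

theorem sum_wTerm_perm (τ η lam : ℂ) {n m : ℕ} (Λ z : Fin n → ℂ)
    (mv : Fin n → ℕ) (t : Fin m → ℂ) (e : Equiv.Perm (Fin m)) :
    ∑ σ, wTerm τ η lam Λ z mv (t ∘ e) σ = ∑ σ, wTerm τ η lam Λ z mv t σ := by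
  rw [← Equiv.sum_comp (Equiv.arrowCongr e.symm (Equiv.refl (Fin n)))]
  apply Finset.sum_congr rfl
  intro σ _
  exact wTerm_perm τ η lam Λ z mv t σ e

theorem prod_lt_swap {m : ℕ} (ρ : Fin m → Fin m → ℂ) (j j' : Fin m) (hj : (j : ℕ) + 1 = j') :
    (∏ i : Fin m, ∏ k : Fin m, if i < k then ρ (Equiv.swap j j' i) (Equiv.swap j j' k) else 1) * ρ j j' =
    (∏ i : Fin m, ∏ k : Fin m, if i < k then ρ i k else 1) * ρ j' j := by
  have h1 : (∏ i : Fin m, ∏ k : Fin m,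
      if i < k then ρ (Equiv.swap j j' i) (Equiv.swap j j' k) else 1) =
      ∏ i : Fin m, ∏ k : Fin m, if Equiv.swap j j' i < Equiv.swap j j' k then ρ i k else 1 := by
    rw [← Equiv.prod_comp (Equiv.swap j j')]
    apply Finset.prod_congr rfl
    intro i _
    rw [← Equiv.prod_comp (Equiv.swap j j')]
    simp
  rw [h1]
  have h2 : ∀ a b : Fin m, ρ a b = ∏ i : Fin m, ∏ k : Fin m, if i = a ∧ k = b then ρ a b else 1 := by
    intro a b
    rw [Finset.prod_eq_single a, Finset.prod_eq_single b]
    · simp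
    · intro k _ hk; simp [hk]
    · simp
    · intro i _ hi; simp [hi]
    · simp
  rw [h2 j j', h2 j' j]
  simp only [← Finset.prod_mul_distrib]
  apply Finset.prod_congr rfl
  intro i _
  apply Finset.prod_congr rfl
  intro k _
  have hne : j ≠ j' := by intro h; rw [h] at hj; omega
  simp only [Equiv.swap_apply_def]
  by_cases a1 : i = j
  · subst a1
    by_cases b1 : k = i
    · subst b1; simp [hne]
    · by_cases b2 : k = j'
      · subst b2
        have : i < k := by omega
        simp [this, hne, b1, this.not_gt]
      · have : j' < k ↔ i < k := by omega
        simp [b1, b2, hne, this]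
  · by_cases a2 : i = j'
    · subst a2
      by_cases b1 : k = j
      · subst b1
        have : k < i := by omega
        simp [this, hne, a1, this.not_gt]
      · by_cases b2 : k = i
        · subst b2; simp [a1]
        · have : j < k ↔ i < k := by omega
          simp [b1, b2, a1, this]
    · by_cases b1 : k = j
      · subst b1
        have : i < j' ↔ i < k := by omega
        simp [a1, a2, this]
      · by_cases b2 : k = j'
        · subst b2
          have : i < j ↔ i < k := by omega
          simp [a1, a2, b1, this]
        · simp [a1, a2, b1, b2]

theorem prod_symm {m : ℕ} (A : Fin m → Fin m → ℂ) (hA : ∀ i, A i i = 1) :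
    ∏ i : Fin m, ∏ k : Fin m, A i k =
      ∏ i : Fin m, ∏ k : Fin m, if i < k then A i k * A k i else 1 := by
  have h : ∀ i k, A i k = (if i < k then A i k else 1) * (if k < i then A i k else 1) := by
    intro i k
    rcases lt_trichotomy i k with h | h | h
    · simp [h, h.not_gt]
    · subst h; simp [hA]
    · simp [h, h.not_gt]
  calc ∏ i : Fin m, ∏ k : Fin m, A i k
      = (∏ i : Fin m, ∏ k : Fin m, if i < k then A i k else 1) *
        (∏ i : Fin m, ∏ k : Fin m, if k < i then A i k else 1) := by
        simp only [← Finset.prod_mul_distrib, ← h]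
    _ = (∏ i : Fin m, ∏ k : Fin m, if i < k then A i k else 1) *
        (∏ i : Fin m, ∏ k : Fin m, if i < k then A k i else 1) := by
        congr 1
        rw [Finset.prod_comm]
    _ = _ := by
        simp only [← Finset.prod_mul_distrib]
        apply Finset.prod_congr rfl
        intro i _
        apply Finset.prod_congr rfl
        intro k _
        split_ifs <;> simp

/-- entire version of one summand -/
noncomputable def gTerm (τ η lam : ℂ) {n m : ℕ} (Λ z : Fin n → ℂ)
    (mv : Fin n → ℕ) (σ : Fin m → Fin n) (t : Fin m → ℂ) : ℂ :=
  (∏ i : Fin m, ∏ k : Fin n,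
    if k < σ i then jacobiTheta1 (t i - z k + η * Λ k) τ
    else if k = σ i then 1 else jacobiTheta1 (t i - z k - η * Λ k) τ) *
  (∏ i : Fin m, ∏ j : Fin m, if i < j then
    (if σ i < σ j then jacobiTheta1 (t i - t j + 2 * η) τ
     else if σ j < σ i then -jacobiTheta1 (t j - t i + 2 * η) τ
     else jacobiTheta1 (t i - t j) τ) else 1) *
  (∏ j : Fin m,
    jacobiTheta1 (lam + t j - z (σ j) - η * Λ (σ j) + 2 * η * (mv (σ j) : ℂ) -
      2 * η * ∑ l ∈ Finset.univ.filter (fun l : Fin n => l < σ j), (Λ l - 2 * (mv l : ℂ))) τ)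

theorem gTerm_analytic {τ : ℂ} (hτ : 0 < τ.im) (η lam : ℂ) {n m : ℕ} (Λ z : Fin n → ℂ)
    (mv : Fin n → ℕ) (σ : Fin m → Fin n) (t : Fin m → ℂ) :
    AnalyticAt ℂ (gTerm τ η lam Λ z mv σ) t := by
  have hθ : ∀ f : (Fin m → ℂ) → ℂ, AnalyticAt ℂ f t →
      AnalyticAt ℂ (fun s => jacobiTheta1 (f s) τ) t := by
    intro f hf
    exact AnalyticAt.fun_comp (g := fun x => jacobiTheta1 x τ) (th_analytic hτ _ (Set.mem_univ _)) hf
  have hp : ∀ i : Fin m, AnalyticAt ℂ (fun s : Fin m → ℂ => s i) t := fun i =>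
    (ContinuousLinearMap.proj (R := ℂ) (φ := fun _ : Fin m => ℂ) i).analyticAt t
  unfold gTerm
  refine AnalyticAt.mul (AnalyticAt.mul ?_ ?_) ?_
  · refine Finset.analyticAt_fun_prod _ fun i _ => Finset.analyticAt_fun_prod _ fun k _ => ?_
    split_ifs
    · apply hθ; exact ((hp i).sub analyticAt_const).add analyticAt_const
    · exact analyticAt_const
    · apply hθ; exact ((hp i).sub analyticAt_const).sub analyticAt_const
  · refine Finset.analyticAt_fun_prod _ fun i _ => Finset.analyticAt_fun_prod _ fun k _ => ?_
    split_ifs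
    · apply hθ; exact ((hp i).sub (hp k)).add analyticAt_const
    · apply AnalyticAt.fun_neg; apply hθ; exact ((hp k).sub (hp i)).add analyticAt_const
    · apply hθ; exact (hp i).sub (hp k)
    · exact analyticAt_const
  · refine Finset.analyticAt_fun_prod _ fun i _ => ?_
    apply hθ; exact ((((analyticAt_const.add (hp i)).sub analyticAt_const).sub analyticAt_const).add analyticAt_const).sub analyticAt_const

open scoped Classical in
theorem gTerm_eq (τ η lam : ℂ) {n m : ℕ} (Λ z : Fin n → ℂ)
    (mv : Fin n → ℕ) (σ : Fin m → Fin n) (t : Fin m → ℂ) (ht : wfDefined τ η Λ z t) :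
    (if ∀ k : Fin n, (Finset.univ.filter fun i => σ i = k).card = mv k then
      gTerm τ η lam Λ z mv σ t else 0) =
    (∏ i : Fin m, ∏ j : Fin m, if i < j then jacobiTheta1 (t i - t j) τ else 1) *
    (∏ i : Fin m, ∏ k : Fin n, jacobiTheta1 (t i - z k - η * Λ k) τ) *
    wTerm τ η lam Λ z mv t σ := by
  obtain ⟨h1, -, h3⟩ := ht
  unfold wTerm gTerm
  split_ifs with hv
  swap
  · simp
  have e1 : (∏ i : Fin m, ∏ k : Fin n,
    if k < σ i then jacobiTheta1 (t i - z k + η * Λ k) τ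
    else if k = σ i then 1 else jacobiTheta1 (t i - z k - η * Λ k) τ) =
    (∏ i : Fin m, ∏ k : Fin n, jacobiTheta1 (t i - z k - η * Λ k) τ) *
    (∏ i : Fin m, ∏ k : Fin n,
          if k < σ i then
            jacobiTheta1 (t i - z k + η * Λ k) τ /
              jacobiTheta1 (t i - z k - η * Λ k) τ
          else 1) * ∏ j : Fin m, (jacobiTheta1 (t j - z (σ j) - η * Λ (σ j)) τ)⁻¹ := by
    simp only [← Finset.prod_mul_distrib]
    apply Finset.prod_congr rfl
    intro i _
    have : (jacobiTheta1 (t i - z (σ i) - η * Λ (σ i)) τ)⁻¹ =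
      ∏ k, if k = σ i then (jacobiTheta1 (t i - z k - η * Λ k) τ)⁻¹ else 1 := by simp
    rw [this]
    simp only [← Finset.prod_mul_distrib]
    apply Finset.prod_congr rfl
    intro k _
    have := h3 i k
    split_ifs with c1 c2 c2
    · exact absurd c2 c1.ne
    · field_simp
    · field_simp
    · simp
  have e2 : (∏ i : Fin m, ∏ j : Fin m, if i < j then
    (if σ i < σ j then jacobiTheta1 (t i - t j + 2 * η) τ
     else if σ j < σ i then -jacobiTheta1 (t j - t i + 2 * η) τ
     else jacobiTheta1 (t i - t j) τ) else 1) =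
     (∏ i : Fin m, ∏ j : Fin m, if i < j then jacobiTheta1 (t i - t j) τ else 1) *
     (∏ i : Fin m, ∏ j : Fin m,
          if σ i < σ j then
            jacobiTheta1 (t i - t j + 2 * η) τ / jacobiTheta1 (t i - t j) τ
          else 1) := by
    rw [prod_symm (fun i j => if σ i < σ j then
            jacobiTheta1 (t i - t j + 2 * η) τ / jacobiTheta1 (t i - t j) τ
          else 1) (by simp)]
    simp only [← Finset.prod_mul_distrib]
    apply Finset.prod_congr rfl
    intro i _
    apply Finset.prod_congr rfl
    intro j _
    by_cases hij : i < j
    swap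
    · simp [hij]
    have a1 := h1 i j hij.ne
    have a2 : jacobiTheta1 (t j - t i) τ = - jacobiTheta1 (t i - t j) τ := by
      rw [← th_odd, neg_sub]
    simp only [hij, if_true]
    rcases lt_trichotomy (σ i) (σ j) with h | h | h
    · simp only [h, h.not_gt, if_true, if_false]
      field_simp
    · simp [h]
    · simp only [h, h.not_gt, if_true, if_false, a2]
      field_simp
  rw [e1, e2]
  simp only [div_eq_mul_inv, Finset.prod_mul_distrib]
  ring

/-- The weight function `ω_{m₁,…,mₙ}(·,λ;z;τ)` lies in the space
`F^m_{a₁,…,aₙ}(z₁,…,zₙ,λ)`: (i) after multiplication by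
`∏_{i<j}θ(t_i−t_j+2η)·∏_{i,k}θ(t_i−z_k−a_k)` it extends holomorphically to
`ℂ^m`; (ii) it is 1-periodic in each `t_j` and quasiperiodic with multiplier
`e^{−2πi(λ+4ηj−2η)}` under `t_j → t_j+τ`; (iii) it is invariant under the
twisted symmetric group action. -/
theorem weightFn_mem_F (τ η lam : ℂ) (n m : ℕ) (Λ z : Fin n → ℂ)
    (mv : Fin n → ℕ) (hτ : 0 < τ.im) (hm : ∑ k, mv k = m) :
    (∃ g : (Fin m → ℂ) → ℂ, (∀ t, AnalyticAt ℂ g t) ∧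
      ∀ t : Fin m → ℂ, wfDefined τ η Λ z t →
        g t = (∏ i : Fin m, ∏ j : Fin m,
                if i < j then jacobiTheta1 (t i - t j + 2 * η) τ else 1) *
          (∏ i : Fin m, ∏ k : Fin n, jacobiTheta1 (t i - z k - η * Λ k) τ) *
          weightFn τ η lam Λ z mv t) ∧
    (∀ (t : Fin m → ℂ) (j : Fin m), wfDefined τ η Λ z t →
        wfDefined τ η Λ z (Function.update t j (t j + 1)) →
        weightFn τ η lam Λ z mv (Function.update t j (t j + 1)) =
          weightFn τ η lam Λ z mv t) ∧
    (∀ (t : Fin m → ℂ) (j : Fin m), wfDefined τ η Λ z t →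
        wfDefined τ η Λ z (Function.update t j (t j + τ)) →
        weightFn τ η lam Λ z mv (Function.update t j (t j + τ)) =
          Complex.exp (-(2 * Real.pi * I *
              (lam + 4 * η * (((j : ℕ) : ℂ) + 1) - 2 * η))) *
            weightFn τ η lam Λ z mv t) ∧
    (∀ (t : Fin m → ℂ) (j j' : Fin m), (j : ℕ) + 1 = (j' : ℕ) →
        wfDefined τ η Λ z t → wfDefined τ η Λ z (t ∘ Equiv.swap j j') →
        weightFn τ η lam Λ z mv (t ∘ Equiv.swap j j') *
            (jacobiTheta1 (t j - t j' - 2 * η) τ /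
              jacobiTheta1 (t j - t j' + 2 * η) τ) =
          weightFn τ η lam Λ z mv t) := by
  refine ⟨?_, ?_, ?_, ?_⟩
  · classical
    refine ⟨fun t => ∑ σ : Fin m → Fin n,
      if ∀ k : Fin n, (Finset.univ.filter fun i => σ i = k).card = mv k then
        gTerm τ η lam Λ z mv σ t else 0, ?_, ?_⟩
    · intro t
      refine Finset.analyticAt_fun_sum _ fun σ _ => ?_
      split_ifs
      · exact gTerm_analytic hτ η lam Λ z mv σ t
      · exact analyticAt_const
    · intro t ht
      have hu : (∏ i : Fin m, ∏ j : Fin m,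
          if i < j then jacobiTheta1 (t i - t j + 2 * η) τ else 1) * (uFn τ η t)⁻¹ =
          ∏ i : Fin m, ∏ j : Fin m, if i < j then jacobiTheta1 (t i - t j) τ else 1 := by
        unfold uFn
        simp only [← Finset.prod_inv_distrib, ← Finset.prod_mul_distrib]
        apply Finset.prod_congr rfl
        intro i _
        apply Finset.prod_congr rfl
        intro j _
        split_ifs with hij
        · have := ht.2.1 i j hij.ne
          field_simp
        · simp
      rw [weightFn_eq]
      calc _ = ∑ σ, (∏ i : Fin m, ∏ j : Fin m, if i < j then jacobiTheta1 (t i - t j) τ else 1) *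
            (∏ i : Fin m, ∏ k : Fin n, jacobiTheta1 (t i - z k - η * Λ k) τ) *
            wTerm τ η lam Λ z mv t σ := by
            apply Finset.sum_congr rfl
            intro σ _
            rw [← gTerm_eq τ η lam Λ z mv σ t ht]
        _ = _ := by
            rw [← Finset.mul_sum, ← hu]
            ring
  · intro t j _ _
    rw [weightFn_shift (qp_one τ)]
    simp
  · intro t j _ _
    rw [weightFn_shift (qp_tau τ)]
    congr 2
    ring
  · intro t j j' hj ht ht'
    have hne : j ≠ j' := by intro h; rw [h] at hj; omega
    rw [weightFn_eq, weightFn_eq, sum_wTerm_perm]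
    have hs := prod_lt_swap (fun a b => jacobiTheta1 (t a - t b + 2 * η) τ /
      jacobiTheta1 (t a - t b) τ) j j' hj
    change uFn τ η (t ∘ Equiv.swap j j') * _ = uFn τ η t * _ at hs
    have a0 := ht.1 j j' hne
    have a1 := ht.2.1 j j' hne
    have a2 := ht.2.1 j' j hne.symm
    have b1 : jacobiTheta1 (t j' - t j) τ = - jacobiTheta1 (t j - t j') τ := by
      rw [← th_odd, neg_sub]
    have b2 : jacobiTheta1 (t j' - t j + 2 * η) τ = - jacobiTheta1 (t j - t j' - 2 * η) τ := by
      rw [← th_odd]; congr 1; ring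
    rw [b2, neg_ne_zero] at a2
    rw [b1, b2, neg_div_neg_eq] at hs
    have hs' : uFn τ η (t ∘ Equiv.swap j j') = uFn τ η t *
        (jacobiTheta1 (t j - t j' - 2 * η) τ / jacobiTheta1 (t j - t j' + 2 * η) τ) := by
      field_simp at hs ⊢
      linear_combination hs
    rw [hs', mul_inv]
    field_simp
end

section
/- Let τ ∈ ℂ with Im τ > 0, η, Λ, M, z, λ ∈ ℂ, and set a = ηΛ, b = ηM. Define the meromorphic functions of t: ω₀₁(t) = θ(λ+2η+t−2a−b)θ(t−z+a)/(θ(t−b)θ(t−z−a)), ω₁₀(t) = θ(λ+2η+t−z−a)/θ(t−z−a), ω̃₀₁(t) = θ(λ+2η+t−b)/θ(t−b), ω̃₁₀(t) = θ(λ+2η+t−z−2b−a)θ(t+b)/(θ(t−z−a)θ(t−b)). Then, wherever all terms are defined, ω̃₀₁(t) = R^{01}_{01}(z,λ;Λ,M) ω₀₁(t) + R^{01}_{10}(z,λ;Λ,M) ω₁₀(t) and ω̃₁₀(t) = R^{10}_{01}(z,λ;Λ,M) ω₀₁(t) + R^{10}_{10}(z,λ;Λ,M) ω₁₀(t), where the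 coefficients are the one-excitation R-matrix entries. -/
open Complex

/-- Even part theta series. -/
noncomputable def thetaEvenTerm (τ x : ℂ) (p : ℤ) : ℂ :=
  Complex.exp (2 * Real.pi * I * τ * p ^ 2 + 4 * Real.pi * I * p * x)

/-- Odd part theta series. -/
noncomputable def thetaOddTerm (τ x : ℂ) (p : ℤ) : ℂ :=
  Complex.exp (Real.pi * I * τ * (2 * p + 1) ^ 2 / 2 + 2 * Real.pi * I * (2 * p + 1) * x)

/-- Terms of the first Jacobi theta function. -/
noncomputable def thetaOneTerm (τ t : ℂ) (j : ℤ) : ℂ :=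
  Complex.exp (Real.pi * I * (j + 1/2) ^ 2 * τ + 2 * Real.pi * I * (j + 1/2) * (t + 1/2))

lemma summable_thetaEvenTerm (τ x : ℂ) (hτ : 0 < τ.im) : Summable (thetaEvenTerm τ x) := by
  have h := (summable_jacobiTheta₂_term_iff (2 * x) (2 * τ)).2 (by simpa using hτ)
  refine h.congr fun p => ?_
  unfold thetaEvenTerm jacobiTheta₂_term
  congr 1
  ring

lemma summable_thetaOddTerm (τ x : ℂ) (hτ : 0 < τ.im) : Summable (thetaOddTerm τ x) := by
  have h := (summable_jacobiTheta₂_term_iff (2 * x + τ) (2 * τ)).2 (by simpa using hτ)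
  refine (h.mul_left (Complex.exp (Real.pi * I * τ / 2 + 2 * Real.pi * I * x))).congr fun p => ?_
  unfold thetaOddTerm jacobiTheta₂_term
  rw [← Complex.exp_add]
  congr 1
  ring

lemma summable_thetaOneTerm (τ x : ℂ) (hτ : 0 < τ.im) : Summable (thetaOneTerm τ x) := by
  have h := (summable_jacobiTheta₂_term_iff (x + 1/2 + τ/2) τ).2 hτ
  refine (h.mul_left (Complex.exp (Real.pi * I * τ / 4 + Real.pi * I * (x + 1/2)))).congr
    fun p => ?_
  unfold thetaOneTerm jacobiTheta₂_term
  rw [← Complex.exp_add]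
  congr 1
  ring

/-- Splitting pairs of integers by the parity of their sum. -/
def paritySplit : (ℤ × ℤ) ⊕ (ℤ × ℤ) → ℤ × ℤ
  | Sum.inl p => (p.1 + p.2, p.1 - p.2 - 1)
  | Sum.inr p => (p.1 + p.2, p.1 - p.2)

lemma paritySplit_bijective : Function.Bijective paritySplit := by
  constructor
  · rintro (⟨a, b⟩ | ⟨a, b⟩) (⟨c, d⟩ | ⟨c, d⟩) h <;>
      simp only [paritySplit, Prod.mk.injEq] at h <;>
      simp only [Sum.inl.injEq, Sum.inr.injEq, Prod.mk.injEq, reduceCtorEq] <;> omega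
  · rintro ⟨j, k⟩
    rcases Int.even_or_odd' (j + k) with ⟨m, hm | hm⟩
    · refine ⟨Sum.inr (m, j - m), ?_⟩
      simp only [paritySplit, Prod.mk.injEq]
      omega
    · refine ⟨Sum.inl (m + 1, j - m - 1), ?_⟩
      simp only [paritySplit, Prod.mk.injEq]
      omega

lemma thetaOne_inl (τ x y : ℂ) (p r : ℤ) :
    thetaOneTerm τ (x + y) (p + r) * thetaOneTerm τ (x - y) (p - r - 1) =
      thetaEvenTerm τ x p * thetaOddTerm τ y r := by
  unfold thetaOneTerm thetaEvenTerm thetaOddTerm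
  rw [← Complex.exp_add, ← Complex.exp_add, Complex.exp_eq_exp_iff_exists_int]
  refine ⟨p, ?_⟩
  push_cast
  ring

lemma thetaOne_inr (τ x y : ℂ) (p r : ℤ) :
    thetaOneTerm τ (x + y) (p + r) * thetaOneTerm τ (x - y) (p - r) =
      -(thetaOddTerm τ x p * thetaEvenTerm τ y r) := by
  unfold thetaOneTerm thetaEvenTerm thetaOddTerm
  rw [← Complex.exp_add, ← Complex.exp_add, ← neg_one_mul, ← Complex.exp_pi_mul_I,
    ← Complex.exp_add, Complex.exp_eq_exp_iff_exists_int]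
  refine ⟨p, ?_⟩
  push_cast
  ring

lemma jacobiTheta1_mul (τ x y : ℂ) (hτ : 0 < τ.im) :
    jacobiTheta1 (x + y) τ * jacobiTheta1 (x - y) τ =
      (∑' p, thetaEvenTerm τ x p) * (∑' p, thetaOddTerm τ y p) -
      (∑' p, thetaOddTerm τ x p) * (∑' p, thetaEvenTerm τ y p) := by
  have e : ∀ t, jacobiTheta1 t τ = -∑' j, thetaOneTerm τ t j := fun t => rfl
  rw [e, e, neg_mul_neg,
    tsum_mul_tsum_of_summable_norm (summable_thetaOneTerm τ _ hτ).norm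
      (summable_thetaOneTerm τ _ hτ).norm,
    tsum_mul_tsum_of_summable_norm (summable_thetaEvenTerm τ _ hτ).norm
      (summable_thetaOddTerm τ _ hτ).norm,
    tsum_mul_tsum_of_summable_norm (summable_thetaOddTerm τ _ hτ).norm
      (summable_thetaEvenTerm τ _ hτ).norm]
  have h1 := (summable_mul_of_summable_norm (summable_thetaEvenTerm τ x hτ).norm
      (summable_thetaOddTerm τ y hτ).norm).hasSum
  have h2 := (summable_mul_of_summable_norm (summable_thetaOddTerm τ x hτ).norm
      (summable_thetaEvenTerm τ y hτ).norm).hasSum.neg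
  rw [← (Equiv.ofBijective _ paritySplit_bijective).tsum_eq,
    sub_eq_add_neg (∑' z : ℤ × ℤ, thetaEvenTerm τ x z.1 * thetaOddTerm τ y z.2)]
  refine HasSum.tsum_eq (HasSum.sum ?_ ?_)
  · refine h1.congr_fun fun q => ?_
    exact thetaOne_inl τ x y q.1 q.2
  · refine h2.congr_fun fun q => ?_
    exact thetaOne_inr τ x y q.1 q.2

/-- The three-term (Weierstrass) identity. -/
lemma jacobiTheta1_three_term (τ x y u v : ℂ) (hτ : 0 < τ.im) :
    (jacobiTheta1 (x + y) τ * jacobiTheta1 (x - y) τ) *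
      (jacobiTheta1 (u + v) τ * jacobiTheta1 (u - v) τ) =
    (jacobiTheta1 (x + u) τ * jacobiTheta1 (x - u) τ) *
      (jacobiTheta1 (y + v) τ * jacobiTheta1 (y - v) τ) -
    (jacobiTheta1 (x + v) τ * jacobiTheta1 (x - v) τ) *
      (jacobiTheta1 (y + u) τ * jacobiTheta1 (y - u) τ) := by
  simp only [jacobiTheta1_mul _ _ _ hτ]
  ring

lemma jacobiTheta1_neg (τ s d : ℂ) (hτ : 0 < τ.im) (hs : jacobiTheta1 s τ ≠ 0) :
    jacobiTheta1 (-d) τ = -jacobiTheta1 d τ := by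
  have h1 := jacobiTheta1_mul τ ((s + d) / 2) ((s - d) / 2) hτ
  have h2 := jacobiTheta1_mul τ ((s - d) / 2) ((s + d) / 2) hτ
  rw [show (s + d) / 2 + (s - d) / 2 = s by ring, show (s + d) / 2 - (s - d) / 2 = d by ring] at h1
  rw [show (s - d) / 2 + (s + d) / 2 = s by ring, show (s - d) / 2 - (s + d) / 2 = -d by ring] at h2
  apply mul_left_cancel₀ hs
  linear_combination h1 + h2

/-- Expansion of the bases `ω̃₀₁, ω̃₁₀` in terms of `ω₀₁, ω₁₀` with the
one-excitation R-matrix entries as coefficients. -/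
theorem R_matrix_one_excitation_expansion
    (τ η Λ M z lam t : ℂ) (hτ : 0 < τ.im)
    (hd1 : jacobiTheta1 (t - η * M) τ ≠ 0)
    (hd2 : jacobiTheta1 (t - z - η * Λ) τ ≠ 0)
    (hd3 : jacobiTheta1 (z - η * Λ - η * M) τ ≠ 0)
    (hd4 : jacobiTheta1 (lam + 2 * η * (1 - Λ)) τ ≠ 0) :
    (jacobiTheta1 (lam + 2 * η + t - η * M) τ / jacobiTheta1 (t - η * M) τ =
      (jacobiTheta1 (z + η * Λ - η * M) τ * jacobiTheta1 (lam + 2 * η) τ /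
        (jacobiTheta1 (z - η * Λ - η * M) τ * jacobiTheta1 (lam + 2 * η * (1 - Λ)) τ)) *
        (jacobiTheta1 (lam + 2 * η + t - 2 * (η * Λ) - η * M) τ *
          jacobiTheta1 (t - z + η * Λ) τ /
          (jacobiTheta1 (t - η * M) τ * jacobiTheta1 (t - z - η * Λ) τ)) +
      (-(jacobiTheta1 (lam + 2 * η + z - η * Λ - η * M) τ * jacobiTheta1 (2 * η * Λ) τ /
        (jacobiTheta1 (z - η * Λ - η * M) τ * jacobiTheta1 (lam + 2 * η * (1 - Λ)) τ))) *
        (jacobiTheta1 (lam + 2 * η + t - z - η * Λ) τ / jacobiTheta1 (t - z - η * Λ) τ)) ∧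
    (jacobiTheta1 (lam + 2 * η + t - z - 2 * (η * M) - η * Λ) τ *
        jacobiTheta1 (t + η * M) τ /
        (jacobiTheta1 (t - z - η * Λ) τ * jacobiTheta1 (t - η * M) τ) =
      (-(jacobiTheta1 (lam + 2 * η - z - η * Λ - η * M) τ * jacobiTheta1 (2 * η * M) τ /
        (jacobiTheta1 (z - η * Λ - η * M) τ * jacobiTheta1 (lam + 2 * η * (1 - Λ)) τ))) *
        (jacobiTheta1 (lam + 2 * η + t - 2 * (η * Λ) - η * M) τ *
          jacobiTheta1 (t - z + η * Λ) τ /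
          (jacobiTheta1 (t - η * M) τ * jacobiTheta1 (t - z - η * Λ) τ)) +
      (jacobiTheta1 (z + η * M - η * Λ) τ * jacobiTheta1 (lam + 2 * η * (1 - Λ - M)) τ /
        (jacobiTheta1 (z - η * Λ - η * M) τ * jacobiTheta1 (lam + 2 * η * (1 - Λ)) τ)) *
        (jacobiTheta1 (lam + 2 * η + t - z - η * Λ) τ / jacobiTheta1 (t - z - η * Λ) τ)) := by
  have k1 := jacobiTheta1_three_term τ ((lam + 2 * η + 2 * t - η * M - z - η * Λ) / 2)
    ((lam + 2 * η - η * M + z + η * Λ) / 2) ((lam + 2 * η + z - 3 * (η * Λ) - η * M) / 2)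
    ((lam + 2 * η - z - η * Λ + η * M) / 2) hτ
  have k2 := jacobiTheta1_three_term τ ((lam + 2 * η + 2 * t - η * M - z - η * Λ) / 2)
    ((lam + 2 * η - 3 * (η * M) - z - η * Λ) / 2) ((lam + 2 * η + z - 3 * (η * Λ) - η * M) / 2)
    ((lam + 2 * η - z - η * Λ + η * M) / 2) hτ
  have o1 := jacobiTheta1_neg τ _ (2 * η * M) hτ hd1
  have o2 := jacobiTheta1_neg τ _ (z + η * M - η * Λ) hτ hd1
  rw [show (lam + 2 * η + 2 * t - η * M - z - η * Λ) / 2 + (lam + 2 * η - η * M + z + η * Λ) / 2 =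
      lam + 2 * η + t - η * M by ring,
    show (lam + 2 * η + 2 * t - η * M - z - η * Λ) / 2 - (lam + 2 * η - η * M + z + η * Λ) / 2 =
      t - z - η * Λ by ring,
    show (lam + 2 * η + z - 3 * (η * Λ) - η * M) / 2 + (lam + 2 * η - z - η * Λ + η * M) / 2 =
      lam + 2 * η * (1 - Λ) by ring,
    show (lam + 2 * η + z - 3 * (η * Λ) - η * M) / 2 - (lam + 2 * η - z - η * Λ + η * M) / 2 =
      z - η * Λ - η * M by ring,
    show (lam + 2 * η + 2 * t - η * M - z - η * Λ) / 2 + (lam + 2 * η + z - 3 * (η * Λ) - η * M) / 2 =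
      lam + 2 * η + t - 2 * (η * Λ) - η * M by ring,
    show (lam + 2 * η + 2 * t - η * M - z - η * Λ) / 2 - (lam + 2 * η + z - 3 * (η * Λ) - η * M) / 2 =
      t - z + η * Λ by ring,
    show (lam + 2 * η - η * M + z + η * Λ) / 2 + (lam + 2 * η - z - η * Λ + η * M) / 2 =
      lam + 2 * η by ring,
    show (lam + 2 * η - η * M + z + η * Λ) / 2 - (lam + 2 * η - z - η * Λ + η * M) / 2 =
      z + η * Λ - η * M by ring,
    show (lam + 2 * η + 2 * t - η * M - z - η * Λ) / 2 + (lam + 2 * η - z - η * Λ + η * M) / 2 =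
      lam + 2 * η + t - z - η * Λ by ring,
    show (lam + 2 * η + 2 * t - η * M - z - η * Λ) / 2 - (lam + 2 * η - z - η * Λ + η * M) / 2 =
      t - η * M by ring,
    show (lam + 2 * η - η * M + z + η * Λ) / 2 + (lam + 2 * η + z - 3 * (η * Λ) - η * M) / 2 =
      lam + 2 * η + z - η * Λ - η * M by ring,
    show (lam + 2 * η - η * M + z + η * Λ) / 2 - (lam + 2 * η + z - 3 * (η * Λ) - η * M) / 2 =
      2 * η * Λ by ring] at k1
  rw [show (lam + 2 * η + 2 * t - η * M - z - η * Λ) / 2 + (lam + 2 * η - 3 * (η * M) - z - η * Λ) / 2 =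
      lam + 2 * η + t - z - 2 * (η * M) - η * Λ by ring,
    show (lam + 2 * η + 2 * t - η * M - z - η * Λ) / 2 - (lam + 2 * η - 3 * (η * M) - z - η * Λ) / 2 =
      t + η * M by ring,
    show (lam + 2 * η + z - 3 * (η * Λ) - η * M) / 2 + (lam + 2 * η - z - η * Λ + η * M) / 2 =
      lam + 2 * η * (1 - Λ) by ring,
    show (lam + 2 * η + z - 3 * (η * Λ) - η * M) / 2 - (lam + 2 * η - z - η * Λ + η * M) / 2 =
      z - η * Λ - η * M by ring,
    show (lam + 2 * η + 2 * t - η * M - z - η * Λ) / 2 + (lam + 2 * η + z - 3 * (η * Λ) - η * M) / 2 =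
      lam + 2 * η + t - 2 * (η * Λ) - η * M by ring,
    show (lam + 2 * η + 2 * t - η * M - z - η * Λ) / 2 - (lam + 2 * η + z - 3 * (η * Λ) - η * M) / 2 =
      t - z + η * Λ by ring,
    show (lam + 2 * η - 3 * (η * M) - z - η * Λ) / 2 + (lam + 2 * η - z - η * Λ + η * M) / 2 =
      lam + 2 * η - z - η * Λ - η * M by ring,
    show (lam + 2 * η - 3 * (η * M) - z - η * Λ) / 2 - (lam + 2 * η - z - η * Λ + η * M) / 2 =
      -(2 * η * M) by ring,
    show (lam + 2 * η + 2 * t - η * M - z - η * Λ) / 2 + (lam + 2 * η - z - η * Λ + η * M) / 2 =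
      lam + 2 * η + t - z - η * Λ by ring,
    show (lam + 2 * η + 2 * t - η * M - z - η * Λ) / 2 - (lam + 2 * η - z - η * Λ + η * M) / 2 =
      t - η * M by ring,
    show (lam + 2 * η - 3 * (η * M) - z - η * Λ) / 2 + (lam + 2 * η + z - 3 * (η * Λ) - η * M) / 2 =
      lam + 2 * η * (1 - Λ - M) by ring,
    show (lam + 2 * η - 3 * (η * M) - z - η * Λ) / 2 - (lam + 2 * η + z - 3 * (η * Λ) - η * M) / 2 =
      -(z + η * M - η * Λ) by ring] at k2
  rw [o1, o2] at k2
  generalize jacobiTheta1 (lam + 2 * η + t - 2 * (η * Λ) - η * M) τ = A at *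
  generalize jacobiTheta1 (lam + 2 * η + t - z - 2 * (η * M) - η * Λ) τ = B at *
  generalize jacobiTheta1 (lam + 2 * η * (1 - Λ)) τ = C at *
  generalize jacobiTheta1 (lam + 2 * η * (1 - Λ - M)) τ = C2 at *
  generalize jacobiTheta1 (lam + 2 * η - z - η * Λ - η * M) τ = C3 at *
  generalize jacobiTheta1 (lam + 2 * η + t - z - η * Λ) τ = C4 at *
  generalize jacobiTheta1 (2 * η * M) τ = C5 at *
  generalize jacobiTheta1 (t - η * M) τ = C6 at *
  generalize jacobiTheta1 (t - z - η * Λ) τ = C7 at *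
  generalize jacobiTheta1 (z - η * Λ - η * M) τ = C8 at *
  constructor
  · field_simp
    linear_combination k1
  · field_simp
    linear_combination k2
end
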